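/- arXiv:2106.10067 — 11 statements merged into one kernel-verified Lean document; each statement's English description precedes it below -/
import Mathlib

section
/- Let d, N ≥ 1, let P⁰, P¹ be d×d row-stochastic matrices, let n_{s,a} (s ∈ {1,…,d}, a ∈ {0,1}) be nonnegative integers with Σ_{s,a} n_{s,a} = N, and set y_{s,a} = n_{s,a}/N. Let (U_{s,a,i})_{s∈{1,…,d}, a∈{0,1}, 1≤i≤n_{s,a}} be independent random variables, each uniformly distributed on [0,1], and for s' ∈ {1,…,d} define M_{s'} = (1/N) Σ_{s,a} Σ_{i=1}^{n_{s,a}} 1{U_{s,a,i} ≤ P^a_{s,s'}}. Then E[ Σ_{s'=1}^d | M_{s'} − Σ_{s,a} y_{s,a} P^a_{s,s'} | ] ≤ √d / √N. -/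
open MeasureTheory ProbabilityTheory

lemma aux_int {Ω : Type*} [MeasurableSpace Ω] (μ : Measure Ω) [IsProbabilityMeasure μ]
    (V : Ω → ℝ) (hm : Measurable V) (hu : Measure.map V μ = volume.restrict (Set.Icc (0 : ℝ) 1))
    (p : ℝ) (h0 : 0 ≤ p) (h1 : p ≤ 1) :
    ∫ ω, (if V ω ≤ p then (1 : ℝ) else 0) ∂μ = p := by
  have hg : Measurable (fun x : ℝ => if x ≤ p then (1 : ℝ) else 0) :=
    Measurable.ite measurableSet_Iic measurable_const measurable_const
  have e1 : ∫ ω, (if V ω ≤ p then (1 : ℝ) else 0) ∂μ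
      = ∫ x, (if x ≤ p then (1 : ℝ) else 0) ∂(Measure.map V μ) :=
    (integral_map hm.aemeasurable hg.aestronglyMeasurable).symm
  have e2 : (fun x : ℝ => if x ≤ p then (1 : ℝ) else 0) = (Set.Iic p).indicator 1 := by
    ext x; simp [Set.indicator_apply]
  rw [e1, hu, e2, integral_indicator_one measurableSet_Iic]
  have e3 : Set.Iic p ∩ Set.Icc (0 : ℝ) 1 = Set.Icc 0 p := by
    ext x
    simp only [Set.mem_inter_iff, Set.mem_Iic, Set.mem_Icc]
    constructor
    · rintro ⟨a, b, c⟩; exact ⟨b, a⟩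
    · rintro ⟨a, b⟩; exact ⟨b, a, b.trans h1⟩
  rw [measureReal_restrict_apply measurableSet_Iic, e3]
  simp [h0]

lemma aux_abs {Ω J : Type*} [Fintype J] [MeasurableSpace Ω] (μ : Measure Ω)
    [IsProbabilityMeasure μ]
    (V : J → Ω → ℝ) (hm : ∀ j, Measurable (V j))
    (hu : ∀ j, Measure.map (V j) μ = volume.restrict (Set.Icc (0 : ℝ) 1))
    (hi : iIndepFun V μ)
    (p : J → ℝ) (h0 : ∀ j, 0 ≤ p j) (h1 : ∀ j, p j ≤ 1) :
    Integrable (fun ω => |∑ j, (if V j ω ≤ p j then (1 : ℝ) else 0) - ∑ j, p j|) μ ∧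
    (∫ ω, |∑ j, (if V j ω ≤ p j then (1 : ℝ) else 0) - ∑ j, p j| ∂μ) ^ 2 ≤ ∑ j, p j := by
  classical
  have hg : ∀ j, Measurable (fun x : ℝ => if x ≤ p j then (1 : ℝ) else 0) := fun j =>
    Measurable.ite measurableSet_Iic measurable_const measurable_const
  set X : J → Ω → ℝ := fun j ω => if V j ω ≤ p j then (1 : ℝ) else 0 with hX
  have hXm : ∀ j, Measurable (X j) := fun j => (hg j).comp (hm j)
  have hXL : ∀ j, MemLp (X j) 2 μ := fun j =>
    MemLp.of_bound (hXm j).aestronglyMeasurable 1 (Filter.Eventually.of_forall fun ω => by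
      simp only [hX]; split_ifs <;> simp)
  have hXi : iIndepFun X μ := hi.comp (fun j x => if x ≤ p j then (1 : ℝ) else 0) hg
  have hE : ∀ j, ∫ ω, X j ω ∂μ = p j := fun j => aux_int μ (V j) (hm j) (hu j) _ (h0 j) (h1 j)
  have hS : MemLp (∑ j, X j) 2 μ := memLp_finsetSum' _ fun j _ => hXL j
  have hvar : Var[∑ j, X j; μ] ≤ ∑ j, p j := by
    rw [IndepFun.variance_sum (fun j _ => hXL j)
      (fun i _ j _ hij => hXi.indepFun hij)]
    refine Finset.sum_le_sum fun j _ => ?_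
    refine (variance_le_expectation_sq (hXm j).aestronglyMeasurable).trans (le_of_eq ?_)
    rw [← hE j]
    congr 1
    ext ω
    simp only [hX, Pi.pow_apply]; split_ifs <;> simp
  have hES : ∫ ω, (∑ j, X j) ω ∂μ = ∑ j, p j := by
    simp only [Finset.sum_apply]
    rw [integral_finsetSum _ fun j _ => (hXL j).integrable (by norm_num)]
    simp [hE]
  have hZ : MemLp (fun ω => |∑ j, X j ω - ∑ j, p j|) 2 μ := by
    have := (hS.sub (memLp_const (∑ j, p j))).abs
    refine this.congr_norm ?_ ?_
    · exact this.1.congr (Filter.Eventually.of_forall fun ω => by simp)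
    · exact Filter.Eventually.of_forall fun ω => by simp
  refine ⟨hZ.integrable (by norm_num), ?_⟩
  have hv := variance_nonneg (fun ω => |∑ j, X j ω - ∑ j, p j|) μ
  rw [variance_eq_sub hZ] at hv
  rw [variance_eq_integral hS.1.aemeasurable, hES] at hvar
  simp only [Pi.pow_apply, sq_abs, Finset.sum_apply] at hv hvar
  linarith

/-- Expected L1 error of the empirical next-state distribution.
`M s'` is the fraction of arms that land in state `s'` when, for each state `s` and
action `a`, `n s a` arms (in state `s`, taking action `a`) make independent Markovian
transitions according to the row-stochastic matrix `P a`. -/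
theorem expected_L1_error_of_next_state
    (d N : ℕ) (hd : 1 ≤ d) (hN : 1 ≤ N)
    (P : Fin 2 → Matrix (Fin d) (Fin d) ℝ)
    (hPnn : ∀ a s s', 0 ≤ P a s s')
    (hProw : ∀ a s, ∑ s', P a s s' = 1)
    (n : Fin d → Fin 2 → ℕ)
    (hn : ∑ s, ∑ a, n s a = N)
    (y : Fin d → Fin 2 → ℝ)
    (hy : ∀ s a, y s a = (n s a : ℝ) / N)
    (Ω : Type*) [MeasurableSpace Ω] (μ : Measure Ω) [IsProbabilityMeasure μ]
    (U : Fin d → Fin 2 → ℕ → Ω → ℝ)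
    (hUmeas : ∀ s a i, Measurable (U s a i))
    (hUunif : ∀ s a i, i < n s a →
      Measure.map (U s a i) μ = volume.restrict (Set.Icc (0 : ℝ) 1))
    (hUindep : iIndepFun
      (fun j : (s : Fin d) × (a : Fin 2) × Fin (n s a) => U j.1 j.2.1 j.2.2) μ)
    (M : Fin d → Ω → ℝ)
    (hM : ∀ s' ω, M s' ω =
      (1 / (N : ℝ)) * ∑ s, ∑ a, ∑ i ∈ Finset.range (n s a),
        (if U s a i ω ≤ P a s s' then (1 : ℝ) else 0)) :
    ∫ ω, (∑ s', |M s' ω - ∑ s, ∑ a, y s a * P a s s'|) ∂μ ≤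
      Real.sqrt d / Real.sqrt N := by
  have hNp : (0 : ℝ) < N := by exact_mod_cast hN
  have hP1 : ∀ a s s', P a s s' ≤ 1 := fun a s s' => by
    rw [← hProw a s]
    exact Finset.single_le_sum (fun t _ => hPnn a s t) (Finset.mem_univ s')
  have key := fun s' => aux_abs μ
    (fun j : (s : Fin d) × (a : Fin 2) × Fin (n s a) => U j.1 j.2.1 j.2.2)
    (fun j => hUmeas _ _ _) (fun j => hUunif _ _ _ j.2.2.2) hUindep
    (fun j => P j.2.1 j.1 s') (fun j => hPnn _ _ _) (fun j => hP1 _ _ _)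
  have hsum : ∀ s', ∑ j : (s : Fin d) × (a : Fin 2) × Fin (n s a), P j.2.1 j.1 s'
      = ∑ s, ∑ a, (n s a : ℝ) * P a s s' := fun s' => by
    simp [Fintype.sum_sigma]
  set T : Fin d → Ω → ℝ := fun s' ω =>
    |∑ j : (s : Fin d) × (a : Fin 2) × Fin (n s a),
      (if U j.1 j.2.1 j.2.2 ω ≤ P j.2.1 j.1 s' then (1 : ℝ) else 0)
      - ∑ j : (s : Fin d) × (a : Fin 2) × Fin (n s a), P j.2.1 j.1 s'| with hT
  have hMT : ∀ s' ω, |M s' ω - ∑ s, ∑ a, y s a * P a s s'| = (1 / (N : ℝ)) * T s' ω := by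
    intro s' ω
    have hpos : (0 : ℝ) ≤ 1 / N := by positivity
    simp only [hT]
    rw [hsum, ← abs_of_nonneg hpos, ← abs_mul, mul_sub, hM]
    congr 2
    · congr 1
      simp only [Fintype.sum_sigma, Finset.sum_range]
    · simp only [Finset.mul_sum, hy]
      refine Finset.sum_congr rfl fun s _ => Finset.sum_congr rfl fun a _ => ?_
      ring
  simp only [hMT]
  rw [integral_finsetSum _ fun s' _ => (key s').1.const_mul _]
  simp only [integral_const_mul]
  rw [← Finset.mul_sum]
  have htot : ∑ s', ∑ s, ∑ a, (n s a : ℝ) * P a s s' = N := by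
    rw [Finset.sum_comm, ← hn]
    push_cast
    refine Finset.sum_congr rfl fun s _ => ?_
    rw [Finset.sum_comm]
    refine Finset.sum_congr rfl fun a _ => ?_
    rw [← Finset.mul_sum, hProw, mul_one]
  have hcs : (∑ s', ∫ ω, T s' ω ∂μ) ^ 2 ≤ d * N := by
    refine (sq_sum_le_card_mul_sum_sq).trans ?_
    rw [Finset.card_univ, Fintype.card_fin, ← htot]
    refine mul_le_mul_of_nonneg_left (Finset.sum_le_sum fun s' _ => ?_) (Nat.cast_nonneg d)
    rw [← hsum]
    exact (key s').2
  have h2 : ∑ s', ∫ ω, T s' ω ∂μ ≤ Real.sqrt d * Real.sqrt N := by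
    rw [← Real.sqrt_mul (Nat.cast_nonneg d)]
    exact Real.le_sqrt_of_sq_le hcs
  have hsN : 0 < Real.sqrt N := Real.sqrt_pos.2 hNp
  rw [le_div_iff₀ hsN]
  calc 1 / (N : ℝ) * (∑ s', ∫ ω, T s' ω ∂μ) * Real.sqrt N
      ≤ 1 / (N : ℝ) * (Real.sqrt d * Real.sqrt N) * Real.sqrt N := by gcongr
    _ = 1 / (N : ℝ) * Real.sqrt d * (Real.sqrt N * Real.sqrt N) := by ring
    _ = Real.sqrt d := by
      rw [Real.mul_self_sqrt hNp.le]; field_simp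
end

section
/- Let d, N ≥ 1, let P⁰, P¹ be d×d row-stochastic matrices, let n_{s,a} (s ∈ {1,…,d}, a ∈ {0,1}) be nonnegative integers with Σ_{s,a} n_{s,a} = N, and set y_{s,a} = n_{s,a}/N. Let (U_{s,a,i})_{s∈{1,…,d}, a∈{0,1}, 1≤i≤n_{s,a}} be independent random variables, each uniformly distributed on [0,1], and for s' ∈ {1,…,d} define M_{s'} = (1/N) Σ_{s,a} Σ_{i=1}^{n_{s,a}} 1{U_{s,a,i} ≤ P^a_{s,s'}}. Then for every ε > 0: P( Σ_{s'=1}^d | M_{s'} − Σ_{s,a} y_{s,a} P^a_{s,s'} | ≥ ε ) ≤ 2 d e^{−2 N ε² / d²}. -/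
open MeasureTheory ProbabilityTheory

lemma hoeff_mean {Ω : Type*} [MeasurableSpace Ω] (μ : Measure Ω) [IsProbabilityMeasure μ]
    (V : Ω → ℝ) (hV : Measurable V) (p : ℝ) (hp0 : 0 ≤ p) (hp1 : p ≤ 1)
    (hu : Measure.map V μ = volume.restrict (Set.Icc (0 : ℝ) 1)) :
    ∫ ω, (if V ω ≤ p then (1 : ℝ) else 0) ∂μ = p := by
  have hf : Measurable (fun x : ℝ => if x ≤ p then (1 : ℝ) else 0) :=
    Measurable.ite measurableSet_Iic measurable_const measurable_const
  have h1 : ∫ ω, (if V ω ≤ p then (1 : ℝ) else 0) ∂μ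
      = ∫ x, (if x ≤ p then (1 : ℝ) else 0) ∂(Measure.map V μ) :=
    (integral_map hV.aemeasurable hf.aestronglyMeasurable).symm
  rw [h1, hu]
  have h2 : (fun x : ℝ => if x ≤ p then (1 : ℝ) else 0)
      = (Set.Iic p).indicator (fun _ => (1 : ℝ)) := by
    ext x; simp [Set.indicator]
  rw [h2, integral_indicator measurableSet_Iic, Measure.restrict_restrict measurableSet_Iic]
  have h3 : Set.Iic p ∩ Set.Icc (0 : ℝ) 1 = Set.Icc 0 p := by
    ext x; simp only [Set.mem_inter_iff, Set.mem_Iic, Set.mem_Icc]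
    constructor
    · rintro ⟨h, h', _⟩; exact ⟨h', h⟩
    · rintro ⟨h, h'⟩; exact ⟨h', h, h'.trans hp1⟩
  rw [h3]
  simp [hp0]

lemma hoeff_coord {Ω ι : Type*} [Fintype ι] [MeasurableSpace Ω] (μ : Measure Ω)
    [IsProbabilityMeasure μ]
    (V : ι → Ω → ℝ) (hV : ∀ i, Measurable (V i)) (p : ι → ℝ)
    (hp0 : ∀ i, 0 ≤ p i) (hp1 : ∀ i, p i ≤ 1)
    (hu : ∀ i, Measure.map (V i) μ = volume.restrict (Set.Icc (0 : ℝ) 1))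
    (hind : iIndepFun V μ) (δ : ℝ) (hδ : 0 ≤ δ) :
    μ {ω | δ ≤ |∑ i, ((if V i ω ≤ p i then (1 : ℝ) else 0) - p i)|} ≤
      ENNReal.ofReal (2 * Real.exp (-2 * δ ^ 2 / Fintype.card ι)) := by
  have hf : ∀ i, Measurable (fun x : ℝ => (if x ≤ p i then (1 : ℝ) else 0) - p i) := fun i =>
    (Measurable.ite measurableSet_Iic measurable_const measurable_const).sub_const _
  set X : ι → Ω → ℝ := fun i ω => (if V i ω ≤ p i then (1 : ℝ) else 0) - p i with hX
  have hindX : iIndepFun X μ := hind.comp _ hf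
  have hsub : ∀ i, HasSubgaussianMGF (X i) ((‖(1 : ℝ) - 0‖₊ / 2) ^ 2) μ := by
    intro i
    have h := hasSubgaussianMGF_of_mem_Icc (μ := μ) (a := 0) (b := 1)
      (X := fun ω => if V i ω ≤ p i then (1 : ℝ) else 0)
      (Measurable.ite (hV i measurableSet_Iic) measurable_const measurable_const).aemeasurable
      (Filter.Eventually.of_forall fun ω => by
        by_cases h : V i ω ≤ p i <;> simp [h])
    rw [hoeff_mean μ (V i) (hV i) (p i) (hp0 i) (hp1 i) (hu i)] at h
    exact h
  have hS := HasSubgaussianMGF.sum_of_iIndepFun hindX (s := Finset.univ) (fun i _ => hsub i)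
  have key : ∀ Y : Ω → ℝ, HasSubgaussianMGF Y (∑ i : ι, (‖(1 : ℝ) - 0‖₊ / 2) ^ 2) μ →
      μ {ω | δ ≤ Y ω} ≤ ENNReal.ofReal (Real.exp (-2 * δ ^ 2 / Fintype.card ι)) := by
    intro Y hY
    have h := hY.measure_ge_le hδ
    rw [← ofReal_measureReal]
    apply ENNReal.ofReal_le_ofReal
    refine h.trans (le_of_eq ?_)
    congr 1
    by_cases hc : (Fintype.card ι : ℝ) = 0
    · simp [hc]
    · simp
      field_simp
  have hsplit : {ω | δ ≤ |∑ i, X i ω|} ⊆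
      {ω | δ ≤ ∑ i, X i ω} ∪ {ω | δ ≤ (-(fun ω => ∑ i, X i ω)) ω} := by
    intro ω hω
    simp only [Set.mem_union, Set.mem_ofPred_eq, Pi.neg_apply] at hω ⊢
    exact le_abs.1 hω
  calc _ ≤ _ := measure_mono hsplit
    _ ≤ _ := measure_union_le _ _
    _ ≤ _ := add_le_add (key _ hS) (key _ hS.neg)
    _ = _ := by rw [← ENNReal.ofReal_add (by positivity) (by positivity), two_mul]

/-- Hoeffding bound on the L1 error of the empirical next-state distribution.
`M s'` is the fraction of arms that land in state `s'` when, for each state `s` and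
action `a`, `n s a` arms (in state `s`, taking action `a`) make independent Markovian
transitions according to the row-stochastic matrix `P a`. -/
theorem hoeffding_bound_on_next_state
    (d N : ℕ) (hd : 1 ≤ d) (hN : 1 ≤ N)
    (P : Fin 2 → Matrix (Fin d) (Fin d) ℝ)
    (hPnn : ∀ a s s', 0 ≤ P a s s')
    (hProw : ∀ a s, ∑ s', P a s s' = 1)
    (n : Fin d → Fin 2 → ℕ)
    (hn : ∑ s, ∑ a, n s a = N)
    (y : Fin d → Fin 2 → ℝ)
    (hy : ∀ s a, y s a = (n s a : ℝ) / N)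
    (Ω : Type*) [MeasurableSpace Ω] (μ : Measure Ω) [IsProbabilityMeasure μ]
    (U : Fin d → Fin 2 → ℕ → Ω → ℝ)
    (hUmeas : ∀ s a i, Measurable (U s a i))
    (hUunif : ∀ s a i, i < n s a →
      Measure.map (U s a i) μ = volume.restrict (Set.Icc (0 : ℝ) 1))
    (hUindep : iIndepFun
      (fun j : (s : Fin d) × (a : Fin 2) × Fin (n s a) => U j.1 j.2.1 j.2.2) μ)
    (M : Fin d → Ω → ℝ)
    (hM : ∀ s' ω, M s' ω =
      (1 / (N : ℝ)) * ∑ s, ∑ a, ∑ i ∈ Finset.range (n s a),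
        (if U s a i ω ≤ P a s s' then (1 : ℝ) else 0)) :
    ∀ ε : ℝ, 0 < ε →
      μ {ω | ε ≤ ∑ s', |M s' ω - ∑ s, ∑ a, y s a * P a s s'|} ≤
        ENNReal.ofReal (2 * d * Real.exp (-2 * N * ε ^ 2 / d ^ 2)) := by
  intro ε hε
  have hNpos : (0 : ℝ) < N := by exact_mod_cast hN
  have hdpos : (0 : ℝ) < d := by exact_mod_cast hd
  have hP1 : ∀ a s s', P a s s' ≤ 1 := fun a s s' => by
    rw [← hProw a s]
    exact Finset.single_le_sum (fun i _ => hPnn a s i) (Finset.mem_univ s')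
  have hcard : (Fintype.card ((s : Fin d) × (a : Fin 2) × Fin (n s a)) : ℝ) = N := by
    rw [← hn]
    simp only [Fintype.card_sigma, Fintype.card_fin]
  have hco : ∀ s' : Fin d, μ {ω | ε / d ≤ |M s' ω - ∑ s, ∑ a, y s a * P a s s'|} ≤
      ENNReal.ofReal (2 * Real.exp (-2 * N * ε ^ 2 / d ^ 2)) := by
    intro s'
    have h := hoeff_coord μ
      (fun j : (s : Fin d) × (a : Fin 2) × Fin (n s a) => U j.1 j.2.1 j.2.2)
      (fun j => hUmeas _ _ _) (fun j => P j.2.1 j.1 s') (fun j => hPnn _ _ _)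
      (fun j => hP1 _ _ _) (fun j => hUunif _ _ _ j.2.2.2) hUindep (N * (ε / d)) (by positivity)
    rw [hcard] at h
    have e1 : -2 * (N * (ε / d)) ^ 2 / (N : ℝ) = -2 * N * ε ^ 2 / d ^ 2 := by
      field_simp
    rw [e1] at h
    refine le_trans (measure_mono ?_) h
    intro ω hω
    simp only [Set.mem_ofPred_eq] at hω ⊢
    have e2 : ∑ j : (s : Fin d) × (a : Fin 2) × Fin (n s a),
        ((if U j.1 j.2.1 j.2.2 ω ≤ P j.2.1 j.1 s' then (1 : ℝ) else 0) - P j.2.1 j.1 s')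
        = N * (M s' ω - ∑ s, ∑ a, y s a * P a s s') := by
      rw [Fintype.sum_sigma, hM, mul_sub, ← mul_assoc, mul_one_div_cancel hNpos.ne', one_mul,
        Finset.mul_sum, ← Finset.sum_sub_distrib]
      refine Finset.sum_congr rfl fun s _ => ?_
      rw [Fintype.sum_sigma, Finset.mul_sum, ← Finset.sum_sub_distrib]
      refine Finset.sum_congr rfl fun a _ => ?_
      rw [Finset.sum_sub_distrib, Finset.sum_range, hy]
      congr 1
      simp
      field_simp
    rw [e2, abs_mul, abs_of_pos hNpos]
    exact mul_le_mul_of_nonneg_left hω hNpos.le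
  have hsub : {ω | ε ≤ ∑ s', |M s' ω - ∑ s, ∑ a, y s a * P a s s'|} ⊆
      ⋃ s' : Fin d, {ω | ε / d ≤ |M s' ω - ∑ s, ∑ a, y s a * P a s s'|} := by
    intro ω hω
    by_contra hcon
    simp only [Set.mem_iUnion, Set.mem_ofPred_eq, not_exists, not_le] at hcon hω
    have hlt := Finset.sum_lt_sum_of_nonempty (s := (Finset.univ : Finset (Fin d)))
      ⟨⟨0, hd⟩, Finset.mem_univ _⟩ (fun i _ => hcon i)
    have : ∑ _i : Fin d, ε / (d : ℝ) = ε := by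
      simp
      field_simp
    linarith
  calc _ ≤ _ := measure_mono hsub
    _ ≤ _ := measure_iUnion_fintype_le _ _
    _ ≤ _ := Finset.sum_le_sum fun s' _ => hco s'
    _ = _ := by
      rw [← ENNReal.ofReal_sum_of_nonneg (fun _ _ => by positivity)]
      congr 1
      simp
      ring
end

section
/- Let d ≥ 1. For α ≥ 0 and c ∈ ℝ^d with nonnegative entries, let g(c, α) ∈ ℝ^d be defined recursively by g(c,α)_i = min(c_i, α − Σ_{j<i} g(c,α)_j) for i = 1,…,d. Then there exists a constant L > 0, depending only on d, such that for all α, α' ≥ 0 and all c, c' ∈ ℝ^d with nonnegative entries: Σ_{i=1}^d |g(c,α)_i − g(c',α')_i| ≤ L ( Σ_{i=1}^d |c_i − c'_i| + |α − α'| ). In particular the greedy water-filling map is Lipschitz continuous. -/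
/-- The greedy water-filling map `(c, α) ↦ g(c, α)`, defined
recursively by `g(c,α)_i = min (c i) (α - ∑_{j<i} g(c,α)_j)`, is Lipschitz
continuous, with a Lipschitz constant depending only on the dimension `d`. -/
theorem waterFilling_lipschitz
    (d : ℕ) (hd : 1 ≤ d) :
    ∃ L > (0 : ℝ), ∀ (α α' : ℝ), 0 ≤ α → 0 ≤ α' →
      ∀ (c c' : Fin d → ℝ), (∀ i, 0 ≤ c i) → (∀ i, 0 ≤ c' i) →
      ∀ (y y' : Fin d → ℝ),
        (∀ i, y i = min (c i) (α - ∑ j ∈ Finset.Iio i, y j)) →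
        (∀ i, y' i = min (c' i) (α' - ∑ j ∈ Finset.Iio i, y' j)) →
        ∑ i, |y i - y' i| ≤ L * ((∑ i, |c i - c' i|) + |α - α'|) := by
  refine ⟨d * (d + 1 : ℝ) ^ d, by positivity, ?_⟩
  intro α α' _ _ c c' _ _ y y' hy hy'
  set D : ℝ := (∑ i, |c i - c' i|) + |α - α'| with hD
  have hS : 0 ≤ ∑ i, |c i - c' i| := Finset.sum_nonneg fun i _ => abs_nonneg _
  have hD0 : 0 ≤ D := by positivity
  have step : ∀ i, |y i - y' i| ≤ D + ∑ j ∈ Finset.Iio i, |y j - y' j| := by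
    intro i
    have h1 : |c i - c' i| ≤ ∑ i, |c i - c' i| :=
      Finset.single_le_sum (f := fun i => |c i - c' i|) (fun i _ => abs_nonneg _)
        (Finset.mem_univ i)
    have h2 : |∑ j ∈ Finset.Iio i, y j - ∑ j ∈ Finset.Iio i, y' j|
        ≤ ∑ j ∈ Finset.Iio i, |y j - y' j| := by
      rw [← Finset.sum_sub_distrib]
      exact Finset.abs_sum_le_sum_abs _ _
    have h3 : 0 ≤ ∑ j ∈ Finset.Iio i, |y j - y' j| :=
      Finset.sum_nonneg fun i _ => abs_nonneg _
    have h4 := abs_min_sub_min_le_max (c i) (α - ∑ j ∈ Finset.Iio i, y j) (c' i)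
      (α' - ∑ j ∈ Finset.Iio i, y' j)
    rw [← hy i, ← hy' i] at h4
    refine h4.trans (max_le ?_ ?_)
    · have := abs_nonneg (α - α')
      linarith
    · have h5 := abs_sub (α - α') (∑ j ∈ Finset.Iio i, y j - ∑ j ∈ Finset.Iio i, y' j)
      rw [sub_sub_sub_comm]
      linarith
  have key : ∀ n : ℕ, ∀ i : Fin d, (i : ℕ) ≤ n → |y i - y' i| ≤ (d + 1 : ℝ) ^ n * D := by
    intro n
    induction n with
    | zero =>
      intro i hi
      have h := step i
      have he : Finset.Iio i = ∅ := by
        ext j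
        simp only [Finset.mem_Iio, Finset.notMem_empty, iff_false, Fin.lt_def]
        omega
      rw [he] at h
      simpa using h
    | succ n ih =>
      intro i hi
      have h := step i
      have hs : ∑ j ∈ Finset.Iio i, |y j - y' j| ≤ d * ((d + 1 : ℝ) ^ n * D) := by
        have h1 := Finset.sum_le_card_nsmul (Finset.Iio i) (fun j => |y j - y' j|)
          ((d + 1 : ℝ) ^ n * D) (fun j hj => ih j (by
            have := Fin.lt_def.1 (Finset.mem_Iio.1 hj)
            omega))
        rw [nsmul_eq_mul] at h1
        refine h1.trans ?_
        have h2 : ((Finset.Iio i).card : ℝ) ≤ d := by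
          have := Finset.card_le_univ (Finset.Iio i)
          rw [Fintype.card_fin] at this
          exact_mod_cast this
        exact mul_le_mul_of_nonneg_right h2 (by positivity)
      have h1 : (1 : ℝ) ≤ (d + 1 : ℝ) ^ n := one_le_pow₀ (by
        have : (0 : ℝ) ≤ d := Nat.cast_nonneg d
        linarith)
      have h2 : D ≤ (d + 1 : ℝ) ^ n * D := le_mul_of_one_le_left hD0 h1
      rw [pow_succ]
      linarith
  have h := Finset.sum_le_card_nsmul Finset.univ (fun j => |y j - y' j|)
    ((d + 1 : ℝ) ^ d * D) (fun j _ => key d j j.2.le)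
  rw [nsmul_eq_mul, Finset.card_univ, Fintype.card_fin] at h
  linarith
end

section
/- Let d ≥ 1, α ≥ 0, let σ be a permutation of {1,…,d}, and let m ∈ ℝ^d have nonnegative entries. Define y ∈ ℝ^d recursively by y_{σ_i} = min(m_{σ_i}, α − Σ_{j<i} y_{σ_j}) for i = 1,…,d. Then the set of states at which y is fractional, {s ∈ {1,…,d} : 0 < y_s < m_s}, has at most one element; that is, y_s ∈ {0, m_s} for all states s except possibly one. -/
/-- A priority policy with order `σ` (filling states one by one
following the permutation `σ` with total budget `α`) produces a vector `y` that is
fractional (`0 < y s < m s`) in at most one state. -/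
theorem priority_policy_at_most_one_fractional_state
    (d : ℕ) (hd : 1 ≤ d) (α : ℝ) (hα : 0 ≤ α)
    (σ : Equiv.Perm (Fin d))
    (m : Fin d → ℝ) (hm : ∀ s, 0 ≤ m s)
    (y : Fin d → ℝ)
    (hy : ∀ i, y (σ i) = min (m (σ i)) (α - ∑ j ∈ Finset.Iio i, y (σ j))) :
    ({s | 0 < y s ∧ y s < m s} : Set (Fin d)).Subsingleton := by
  have hS : ∀ n : ℕ, ∑ j ∈ Finset.univ.filter (fun j : Fin d => j.val < n), y (σ j) ≤ α := by
    intro n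
    induction n with
    | zero => simpa using hα
    | succ n ih =>
      by_cases h : n < d
      · have e : Finset.univ.filter (fun j : Fin d => j.val < n + 1)
            = insert ⟨n, h⟩ (Finset.Iio (⟨n, h⟩ : Fin d)) := by
          ext j
          simp only [Finset.mem_filter, Finset.mem_univ, true_and, Finset.mem_insert,
            Finset.mem_Iio, Fin.lt_def, Fin.ext_iff]
          omega
        rw [e, Finset.sum_insert (by simp)]
        have h1 := hy ⟨n, h⟩
        have h2 := min_le_right (m (σ ⟨n, h⟩)) (α - ∑ j ∈ Finset.Iio (⟨n, h⟩ : Fin d), y (σ j))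
        linarith
      · have e : Finset.univ.filter (fun j : Fin d => j.val < n + 1)
            = Finset.univ.filter (fun j : Fin d => j.val < n) := by
          ext j
          simp only [Finset.mem_filter, Finset.mem_univ, true_and]
          omega
        rw [e]
        exact ih
  have hnn : ∀ i, 0 ≤ y (σ i) := by
    intro i
    rw [hy i]
    refine le_min (hm _) ?_
    have h := hS i.val
    have e : Finset.univ.filter (fun j : Fin d => j.val < i.val) = Finset.Iio i := by
      ext j
      simp
    rw [e] at h
    linarith
  have key : ∀ i k, i < k → y (σ i) < m (σ i) → y (σ k) ≤ 0 := by
    intro i k hik hi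
    have h1 : y (σ i) = α - ∑ j ∈ Finset.Iio i, y (σ j) := by
      rcases min_choice (m (σ i)) (α - ∑ j ∈ Finset.Iio i, y (σ j)) with h | h
      · have := hy i
        rw [h] at this
        linarith
      · rw [← h]
        exact hy i
    have h2 : ∑ j ∈ insert i (Finset.Iio i), y (σ j) ≤ ∑ j ∈ Finset.Iio k, y (σ j) := by
      apply Finset.sum_le_sum_of_subset_of_nonneg
      · intro j hj
        simp only [Finset.mem_insert, Finset.mem_Iio] at hj ⊢
        rcases hj with h | h
        · rw [h]
          exact hik
        · exact h.trans hik
      · intro j _ _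
        exact hnn j
    rw [Finset.sum_insert (by simp)] at h2
    have h3 := hy k
    have h4 := min_le_right (m (σ k)) (α - ∑ j ∈ Finset.Iio k, y (σ j))
    linarith
  rintro s ⟨hs0, hs1⟩ t ⟨ht0, ht1⟩
  obtain ⟨i, rfl⟩ := σ.surjective s
  obtain ⟨k, rfl⟩ := σ.surjective t
  rcases lt_trichotomy i k with h | h | h
  · exact absurd (key i k h hs1) (not_le.mpr ht0)
  · rw [h]
  · exact absurd (key k i h ht1) (not_le.mpr hs0)
end

section
/- Let d ≥ 1, 0 ≤ α, and let y* ∈ ℝ^{2d} be indexed as y*_{s,a} for s ∈ {1,…,d}, a ∈ {0,1}, with y*_{s,a} ≥ 0 and Σ_{s} y*_{s,1} = α. Set m*_s = y*_{s,0} + y*_{s,1}, and define S⁺ = {s : y*_{s,1} > 0 and y*_{s,0} = 0}, S⁰ = {s : y*_{s,1} > 0 and y*_{s,0} > 0}. Assume |S⁰| ≤ 1, and let σ be any permutation of {1,…,d} that lists first all elements of S⁺ (in any order), then the element of S⁰ (if any), then the remaining states (in any order). Then the priority map with order σ applied to m* recovers y*: the vector y defined recursively by y_{σ_i} = min(m*_{σ_i},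 α − Σ_{j<i} y_{σ_j}) satisfies y_s = y*_{s,1} for every state s. -/
/-- If `y*` is a nonnegative state-action vector with activation
budget `α`, whose set `S⁰` of randomizing states has at most one element, and if
`σ` is a permutation listing first all states of `S⁺`, then the state of `S⁰`
(if any), then the remaining states, then the priority map with order `σ` applied
to the configuration `m* = y*_{·,0} + y*_{·,1}` recovers the activation part of
`y*`. -/
theorem priority_policy_recovers_LP_solution
    (d : ℕ) (hd : 1 ≤ d) (α : ℝ) (hα : 0 ≤ α)
    (ystar : Fin d → Fin 2 → ℝ)
    (hpos : ∀ s a, 0 ≤ ystar s a)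
    (hbudget : ∑ s, ystar s 1 = α)
    (mstar : Fin d → ℝ) (hmstar : ∀ s, mstar s = ystar s 0 + ystar s 1)
    (Splus S0 : Set (Fin d))
    (hSplus : Splus = {s | 0 < ystar s 1 ∧ ystar s 0 = 0})
    (hS0 : S0 = {s | 0 < ystar s 1 ∧ 0 < ystar s 0})
    (hS0card : S0.Subsingleton)
    (σ : Equiv.Perm (Fin d))
    (hσ1 : ∀ i j : Fin d, σ i ∈ Splus → σ j ∉ Splus → i < j)
    (hσ2 : ∀ i j : Fin d, σ i ∈ S0 → σ j ∉ Splus → σ j ∉ S0 → i < j)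
    (y : Fin d → ℝ)
    (hy : ∀ i, y (σ i) = min (mstar (σ i)) (α - ∑ j ∈ Finset.Iio i, y (σ j))) :
    ∀ s, y s = ystar s 1 := by
  subst hSplus hS0
  have key : ∀ i, y (σ i) = ystar (σ i) 1 := by
    intro i
    induction i using WellFoundedLT.induction with
    | _ i ih =>
    have h1 : ∑ j ∈ Finset.Iio i, y (σ j) = ∑ j ∈ Finset.Iio i, ystar (σ j) 1 :=
      Finset.sum_congr rfl fun j hj => ih j (Finset.mem_Iio.1 hj)
    have h2 : ∑ j, ystar (σ j) 1 = α := by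
      rw [← hbudget]
      exact Equiv.sum_comp σ (fun s => ystar s 1)
    have h3 : ∑ j ∈ Finset.Iio i, ystar (σ j) 1 + ∑ j ∈ (Finset.Iio i)ᶜ, ystar (σ j) 1 = α := by
      rw [← h2]
      exact Finset.sum_add_sum_compl _ _
    have hi : i ∈ (Finset.Iio i)ᶜ := by simp
    rw [hy, h1, hmstar]
    by_cases hp : 0 < ystar (σ i) 1 ∧ ystar (σ i) 0 = 0
    · have h4 : ystar (σ i) 1 ≤ ∑ j ∈ (Finset.Iio i)ᶜ, ystar (σ j) 1 :=
        Finset.single_le_sum (f := fun j => ystar (σ j) 1) (fun j _ => hpos _ _) hi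
      rw [hp.2, zero_add]
      exact min_eq_left (by linarith)
    · have h4 : ∑ j ∈ (Finset.Iio i)ᶜ, ystar (σ j) 1 = ystar (σ i) 1 := by
        refine Finset.sum_eq_single_of_mem i hi fun j hj hne => ?_
        have hij : i ≤ j := by simpa using hj
        by_contra h0
        have hj1 : 0 < ystar (σ j) 1 := lt_of_le_of_ne (hpos _ _) (Ne.symm h0)
        rcases (hpos (σ j) 0).eq_or_lt with hz | hz
        · exact absurd (hσ1 j i ⟨hj1, hz.symm⟩ hp) (not_lt.2 hij)
        · by_cases hi0 : σ i ∈ {s | 0 < ystar s 1 ∧ 0 < ystar s 0}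
          · exact hne (σ.injective (hS0card ⟨hj1, hz⟩ hi0))
          · exact absurd (hσ2 j i ⟨hj1, hz⟩ hp hi0) (not_lt.2 hij)
      have := hpos (σ i) 0
      rw [min_eq_right (by linarith)]
      linarith
  intro s
  simpa using key (σ.symm s)
end

section
/- Let d ≥ 1, α ≥ 0, let S⁺ ⊆ {1,…,d}, let s₀ ∉ S⁺ be a state, and let σ be a permutation of {1,…,d} listing first the elements of S⁺ (in any order), then s₀, then the remaining states. Then for every m ∈ ℝ^d with nonnegative entries satisfying Σ_{s ∈ S⁺} m_s ≤ α ≤ Σ_{s ∈ S⁺} m_s + m_{s₀}, the priority map with order σ (defined recursively by y_{σ_i} = min(m_{σ_i}, α − Σ_{j<i} y_{σ_j})) outputs y_s = m_s for s ∈ S⁺, y_{s₀} = α − Σ_{s ∈ S⁺} m_s, and y_s = 0 for all other states s. In particular, the priority map agrees with an affine function of m on this region. -/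
/-- If `σ` lists first the elements of `S⁺`, then `s₀ ∉ S⁺`, then
the remaining states, then on the region where `∑_{s ∈ S⁺} m s ≤ α ≤ ∑_{s ∈ S⁺} m s + m s₀`,
the priority map with order `σ` activates `m s` in every state of `S⁺`, the residual
budget in `s₀`, and nothing elsewhere; in particular it is affine in `m` there. -/
theorem priority_policy_locally_affine
    (d : ℕ) (hd : 1 ≤ d) (α : ℝ) (hα : 0 ≤ α)
    (S : Finset (Fin d)) (s0 : Fin d) (hs0 : s0 ∉ S)
    (σ : Equiv.Perm (Fin d))
    (hσ1 : ∀ i j : Fin d, σ i ∈ S → σ j ∉ S → i < j)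
    (hσ2 : ∀ j : Fin d, σ j ∉ S → σ j ≠ s0 → σ.symm s0 < j)
    (m : Fin d → ℝ) (hm : ∀ s, 0 ≤ m s)
    (hlow : ∑ s ∈ S, m s ≤ α) (hhigh : α ≤ (∑ s ∈ S, m s) + m s0)
    (y : Fin d → ℝ)
    (hy : ∀ i, y (σ i) = min (m (σ i)) (α - ∑ j ∈ Finset.Iio i, y (σ j))) :
    (∀ s ∈ S, y s = m s) ∧
    y s0 = α - ∑ s ∈ S, m s ∧
    (∀ s, s ∉ S → s ≠ s0 → y s = 0) := by
  have hS : ∀ (f : Fin d → ℝ), ∑ j ∈ S.map σ.symm.toEmbedding, f (σ j) = ∑ s ∈ S, f s := by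
    intro f
    rw [Finset.sum_map]
    simp
  have hmem : ∀ j, j ∈ S.map σ.symm.toEmbedding ↔ σ j ∈ S := by
    intro j
    simp only [Finset.mem_map, Equiv.coe_toEmbedding]
    constructor
    · rintro ⟨a, ha, rfl⟩
      simpa using ha
    · intro h
      exact ⟨σ j, h, by simp⟩
  have h1 : ∀ i, σ i ∈ S → y (σ i) = m (σ i) := by
    intro i
    induction i using WellFoundedLT.induction with
    | ind i ih =>
      intro hi
      have hlt : ∀ j, j < i → σ j ∈ S := by
        intro j hj
        by_contra h
        exact absurd (hσ1 i j hi h) (not_lt.mpr hj.le)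
      have e : ∑ j ∈ Finset.Iio i, y (σ j) = ∑ j ∈ Finset.Iio i, m (σ j) :=
        Finset.sum_congr rfl fun j hj =>
          ih j (Finset.mem_Iio.mp hj) (hlt j (Finset.mem_Iio.mp hj))
      have e2 : ∑ j ∈ insert i (Finset.Iio i), m (σ j) ≤ ∑ s ∈ S, m s := by
        rw [← hS m]
        apply Finset.sum_le_sum_of_subset_of_nonneg
        · intro j hj
          rw [hmem]
          rcases Finset.mem_insert.mp hj with rfl | hj
          · exact hi
          · exact hlt j (Finset.mem_Iio.mp hj)
        · intro j _ _
          exact hm _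
      rw [Finset.sum_insert (by simp)] at e2
      rw [hy i, e]
      apply min_eq_left
      linarith
  have h1' : ∀ s ∈ S, y s = m s := by
    intro s hs
    have := h1 (σ.symm s) (by simpa using hs)
    simpa using this
  have hsum : ∑ s ∈ S, y s = ∑ s ∈ S, m s := Finset.sum_congr rfl h1'
  have h2 : y s0 = α - ∑ s ∈ S, m s := by
    have e : Finset.Iio (σ.symm s0) = S.map σ.symm.toEmbedding := by
      ext j
      rw [hmem, Finset.mem_Iio]
      constructor
      · intro hj
        by_contra h
        have hne : σ j ≠ s0 := by
          rintro rfl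
          simp at hj
        exact absurd (hσ2 j h hne) (not_lt.mpr hj.le)
      · intro hj
        exact hσ1 j _ hj (by simpa using hs0)
    have := hy (σ.symm s0)
    rw [e, hS y, hsum, Equiv.apply_symm_apply] at this
    rw [this]
    apply min_eq_right
    linarith
  have h3 : ∀ i, σ i ∉ S → σ i ≠ s0 → y (σ i) = 0 := by
    intro i
    induction i using WellFoundedLT.induction with
    | ind i ih =>
      intro hi hi0
      have e : ∑ j ∈ insert (σ.symm s0) (S.map σ.symm.toEmbedding), y (σ j)
          = ∑ j ∈ Finset.Iio i, y (σ j) := by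
        apply Finset.sum_subset
        · intro j hj
          rw [Finset.mem_Iio]
          rcases Finset.mem_insert.mp hj with rfl | hj
          · exact hσ2 i hi hi0
          · exact hσ1 j i ((hmem j).mp hj) hi
        · intro j hj hn
          rw [Finset.mem_insert, hmem, not_or] at hn
          refine ih j (Finset.mem_Iio.mp hj) hn.2 ?_
          intro h
          exact hn.1 (by rw [← h]; simp)
      rw [Finset.sum_insert (by rw [hmem]; simpa using hs0), hS y, hsum,
        Equiv.apply_symm_apply, h2] at e
      rw [hy i, ← e]
      have := hm (σ i)
      rw [min_eq_right] <;> linarith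
  refine ⟨h1', h2, ?_⟩
  intro s hs hs'
  have := h3 (σ.symm s) (by simpa using hs) (by simpa using hs')
  simpa using this
end

section
/- Let d ≥ 2, 0 < α < 1, let m* ∈ Δ^d satisfy m*_s > 0 for all s, and let S⁺ be a nonempty proper subset of {1,…,d} with Σ_{s ∈ S⁺} m*_s = α. Then there exist no d×d real matrix A and no ε > 0 such that, for every m ∈ Δ^d with ‖m − m*‖₁ ≤ ε, the vector v = A m satisfies 0 ≤ v_s ≤ m_s for every s and Σ_s v_s = α, while additionally (A m*)_s = m*_s for every s ∈ S⁺ and (A m*)_s = 0 for every s ∉ S⁺. That is, when the states in S⁺ exhaust the activation budget exactly (a degenerate situation), no admissible policy can be linear in a neighborhood of m* while activating exactly the states of S⁺ at m*. -/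
/-- In a degenerate situation where the states of `S⁺` exhaust the
activation budget exactly (`∑_{s ∈ S⁺} m*_s = α`), no admissible policy can be given
by a linear map in an L1-neighbourhood of `m*` in the simplex while activating
exactly the states of `S⁺` at `m*`. -/
theorem no_locally_linear_admissible_policy_in_degenerate_case
    (d : ℕ) (hd : 2 ≤ d) (α : ℝ) (hα0 : 0 < α) (hα1 : α < 1)
    (mstar : Fin d → ℝ) (hmpos : ∀ s, 0 < mstar s) (hmsum : ∑ s, mstar s = 1)
    (S : Finset (Fin d)) (hSne : S.Nonempty) (hSproper : S ≠ Finset.univ)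
    (hSα : ∑ s ∈ S, mstar s = α) :
    ¬ ∃ (A : Matrix (Fin d) (Fin d) ℝ) (ε : ℝ), 0 < ε ∧
      (∀ m : Fin d → ℝ, (∀ s, 0 ≤ m s) → ∑ s, m s = 1 →
        (∑ s, |m s - mstar s|) ≤ ε →
        (∀ s, 0 ≤ A.mulVec m s ∧ A.mulVec m s ≤ m s) ∧ ∑ s, A.mulVec m s = α) ∧
      (∀ s ∈ S, A.mulVec mstar s = mstar s) ∧
      (∀ s ∉ S, A.mulVec mstar s = 0) := by
  rintro ⟨A, ε, hε, hA, hS1, hS0⟩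
  obtain ⟨a, ha⟩ := hSne
  obtain ⟨b, hb⟩ : ∃ b, b ∉ S := by
    by_contra h
    push Not at h
    exact hSproper (Finset.eq_univ_iff_forall.2 h)
  have hab : a ≠ b := fun h => hb (h ▸ ha)
  obtain ⟨t, ht, hta, htb, hte⟩ :
      ∃ t : ℝ, 0 < t ∧ t ≤ mstar a ∧ t ≤ mstar b ∧ t ≤ ε / 2 :=
    ⟨min (mstar a) (min (mstar b) (ε / 2)),
      lt_min (hmpos a) (lt_min (hmpos b) (by linarith)), min_le_left _ _,
      (min_le_right _ _).trans (min_le_left _ _),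
      (min_le_right _ _).trans (min_le_right _ _)⟩
  obtain ⟨u, hu⟩ : ∃ u : Fin d → ℝ,
      ∀ s, u s = (if s = a then t else 0) - (if s = b then t else 0) :=
    ⟨_, fun _ => rfl⟩
  have husum : ∑ s, u s = 0 := by simp [hu, Finset.sum_sub_distrib]
  have huS : ∑ s ∈ S, u s = t := by simp [hu, Finset.sum_sub_distrib, ha, hb]
  have huabs : ∑ s, |u s| ≤ ε := by
    calc ∑ s, |u s| ≤ ∑ s, ((if s = a then t else 0) + (if s = b then t else 0)) := by
          apply Finset.sum_le_sum
          intro s _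
          rw [hu, abs_le]
          constructor <;> split_ifs <;> linarith
      _ = t + t := by simp [Finset.sum_add_distrib]
      _ ≤ ε := by linarith
  have hbd : ∀ s, |u s| ≤ mstar s := by
    intro s
    have := hmpos s
    rw [hu, abs_le]
    by_cases h1 : s = a
    · subst h1; simp [hab]; constructor <;> linarith
    · by_cases h2 : s = b
      · subst h2; simp [h1]; constructor <;> linarith
      · simp [h1, h2]; linarith
  have hp := hA (mstar + u)
    (fun s => by have := (abs_le.1 (hbd s)).1; simp only [Pi.add_apply]; linarith)
    (by simp [Finset.sum_add_distrib, husum, hmsum]) (by simpa using huabs)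
  have hm := hA (mstar - u)
    (fun s => by have := (abs_le.1 (hbd s)).2; simp only [Pi.sub_apply]; linarith)
    (by simp [Finset.sum_sub_distrib, husum, hmsum]) (by simpa using huabs)
  simp only [Matrix.mulVec_add, Matrix.mulVec_sub, Pi.add_apply, Pi.sub_apply] at hp hm
  have e1 : ∀ s ∈ S, A.mulVec u s = u s := fun s hs => by
    have h1 := (hp.1 s).2
    have h2 := (hm.1 s).2
    rw [hS1 s hs] at h1 h2
    linarith
  have e0 : ∀ s ∉ S, A.mulVec u s = 0 := fun s hs => by
    have h1 := (hp.1 s).1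
    have h2 := (hm.1 s).1
    rw [hS0 s hs] at h1 h2
    linarith
  have h1 := hp.2
  have h2 := hm.2
  rw [Finset.sum_add_distrib] at h1
  rw [Finset.sum_sub_distrib] at h2
  have h3 : ∑ s ∈ S, A.mulVec u s = ∑ s, A.mulVec u s :=
    Finset.sum_subset (Finset.subset_univ S) (fun s _ hs => e0 s hs)
  rw [Finset.sum_congr rfl e1, huS] at h3
  linarith
end

section
/- Let d ≥ 1, let P⁰, P¹ be d×d row-stochastic matrices, R⁰, R¹ ∈ ℝ^d, α ∈ [0,1], m ∈ Δ^d, and T ≥ 1. Then the finite-horizon relaxed LP admits an optimal solution y* such that Σ_{t=0}^{T−1} |{s : y*_{s,0}(t) > 0 and y*_{s,1}(t) > 0}| ≤ T; that is, the total number of time–state pairs at which the optimal solution randomizes is at most the horizon T. -/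
def FeasY (d T : ℕ) (hT : 1 ≤ T) (P : Fin 2 → Matrix (Fin d) (Fin d) ℝ) (α : ℝ) (m : Fin d → ℝ) :
    Set (Fin T → Fin d → Fin 2 → ℝ) :=
  {y | (∀ t s a, 0 ≤ y t s a) ∧
      (∀ (t : ℕ) (ht : t + 1 < T) (s : Fin d),
        y ⟨t + 1, ht⟩ s 0 + y ⟨t + 1, ht⟩ s 1 =
          ∑ s', ∑ a, y ⟨t, by omega⟩ s' a * P a s' s) ∧
      (∀ t, ∑ s, y t s 1 = α) ∧
      (∀ s, y ⟨0, by omega⟩ s 0 + y ⟨0, by omega⟩ s 1 = m s)}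

def HomY (d T : ℕ) (hT : 1 ≤ T) (P : Fin 2 → Matrix (Fin d) (Fin d) ℝ)
    (v : Fin T → Fin d → Fin 2 → ℝ) : Prop :=
      (∀ (t : ℕ) (ht : t + 1 < T) (s : Fin d),
        v ⟨t + 1, ht⟩ s 0 + v ⟨t + 1, ht⟩ s 1 =
          ∑ s', ∑ a, v ⟨t, by omega⟩ s' a * P a s' s) ∧
      (∀ t, ∑ s, v t s 1 = 0) ∧
      (∀ s, v ⟨0, by omega⟩ s 0 + v ⟨0, by omega⟩ s 1 = 0)

lemma feas_add (d T : ℕ) (hT : 1 ≤ T) (P : Fin 2 → Matrix (Fin d) (Fin d) ℝ) (α : ℝ)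
    (m : Fin d → ℝ) (y v : Fin T → Fin d → Fin 2 → ℝ) (hy : y ∈ FeasY d T hT P α m)
    (hv : HomY d T hT P v) (l : ℝ) (hn : ∀ t s a, 0 ≤ y t s a + l * v t s a) :
    (fun t s a => y t s a + l * v t s a) ∈ FeasY d T hT P α m := by
  obtain ⟨_, h1, h2, h3⟩ := hy
  obtain ⟨g1, g2, g3⟩ := hv
  refine ⟨hn, ?_, ?_, ?_⟩
  · intro t ht s
    have e : ∑ s', ∑ a, (y ⟨t, by omega⟩ s' a + l * v ⟨t, by omega⟩ s' a) * P a s' s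
      = ∑ s', ∑ a, y ⟨t, by omega⟩ s' a * P a s' s
        + l * ∑ s', ∑ a, v ⟨t, by omega⟩ s' a * P a s' s := by
      simp only [Finset.mul_sum, ← Finset.sum_add_distrib]
      refine Finset.sum_congr rfl fun _ _ => Finset.sum_congr rfl fun _ _ => by ring
    rw [e, ← h1 t ht s, ← g1 t ht s]; ring
  · intro t
    simp only [Finset.sum_add_distrib, ← Finset.mul_sum, h2 t, g2 t]; ring
  · intro s
    have := h3 s; have := g3 s
    linear_combination h3 s + l * g3 s

lemma feas_le_one (d T : ℕ) (hT : 1 ≤ T) (P : Fin 2 → Matrix (Fin d) (Fin d) ℝ)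
    (hProw : ∀ a s, ∑ s', P a s s' = 1) (α : ℝ)
    (m : Fin d → ℝ) (hmsum : ∑ s, m s = 1)
    (y : Fin T → Fin d → Fin 2 → ℝ) (hy : y ∈ FeasY d T hT P α m) :
    ∀ t s a, y t s a ≤ 1 := by
  obtain ⟨h0, h1, h2, h3⟩ := hy
  have key : ∀ (t : ℕ) (ht : t < T), ∑ s, ∑ a, y ⟨t, ht⟩ s a = 1 := by
    intro t
    induction t with
    | zero =>
      intro ht
      simp only [Fin.sum_univ_two]
      rw [← hmsum]
      exact Finset.sum_congr rfl fun s _ => h3 s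
    | succ t ih =>
      intro ht
      rw [← ih (by omega)]
      calc ∑ s, ∑ a, y ⟨t+1, ht⟩ s a = ∑ s, ∑ s', ∑ a, y ⟨t, by omega⟩ s' a * P a s' s := by
            simp only [Fin.sum_univ_two (f := fun a => y ⟨t+1, ht⟩ _ a)]
            exact Finset.sum_congr rfl fun s _ => h1 t ht s
        _ = ∑ s', ∑ a, ∑ s, y ⟨t, by omega⟩ s' a * P a s' s := by
            rw [Finset.sum_comm]
            exact Finset.sum_congr rfl fun s _ => Finset.sum_comm
        _ = _ := by
            simp only [← Finset.mul_sum, hProw, mul_one]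
  rintro ⟨t, ht⟩ s a
  rw [← key t ht]
  calc y ⟨t, ht⟩ s a ≤ ∑ a, y ⟨t, ht⟩ s a :=
        Finset.single_le_sum (f := fun a => y ⟨t, ht⟩ s a) (fun a _ => h0 _ s a) (Finset.mem_univ a)
    _ ≤ _ := Finset.single_le_sum (f := fun s => ∑ a, y ⟨t, ht⟩ s a)
        (fun s _ => Finset.sum_nonneg fun a _ => h0 _ s a) (Finset.mem_univ s)

lemma feas_compact (d T : ℕ) (hT : 1 ≤ T) (P : Fin 2 → Matrix (Fin d) (Fin d) ℝ)
    (hProw : ∀ a s, ∑ s', P a s s' = 1) (α : ℝ)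
    (m : Fin d → ℝ) (hmsum : ∑ s, m s = 1) : IsCompact (FeasY d T hT P α m) := by
  have hb : FeasY d T hT P α m ⊆ Set.Icc 0 1 := fun y hy =>
    ⟨fun t s a => hy.1 t s a, fun t s a => feas_le_one d T hT P hProw α m hmsum y hy t s a⟩
  refine IsCompact.of_isClosed_subset isCompact_Icc ?_ hb
  unfold FeasY
  simp only [Set.setOf_and, Set.setOf_forall]
  refine IsClosed.inter ?_ (IsClosed.inter ?_ (IsClosed.inter ?_ ?_))
  · refine isClosed_iInter fun t => isClosed_iInter fun s => isClosed_iInter fun a =>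
      isClosed_le (by fun_prop) (by fun_prop)
  · refine isClosed_iInter fun t => isClosed_iInter fun s => isClosed_iInter fun a =>
      isClosed_eq (by fun_prop) (by fun_prop)
  · refine isClosed_iInter fun t => isClosed_eq (by fun_prop) (by fun_prop)
  · refine isClosed_iInter fun t => isClosed_eq (by fun_prop) (by fun_prop)

def xseq (d : ℕ) (P : Fin 2 → Matrix (Fin d) (Fin d) ℝ) (w : Fin 2 → ℝ) (m : Fin d → ℝ) :
    ℕ → Fin d → ℝ
  | 0 => m
  | t + 1 => fun s => ∑ s', ∑ a, (w a * xseq d P w m t s') * P a s' s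

lemma feas_nonempty (d T : ℕ) (hT : 1 ≤ T) (P : Fin 2 → Matrix (Fin d) (Fin d) ℝ)
    (hPnn : ∀ a s s', 0 ≤ P a s s')
    (hProw : ∀ a s, ∑ s', P a s s' = 1) (α : ℝ) (hα : α ∈ Set.Icc (0 : ℝ) 1)
    (m : Fin d → ℝ) (hmnn : ∀ s, 0 ≤ m s) (hmsum : ∑ s, m s = 1) :
    (FeasY d T hT P α m).Nonempty := by
  set w : Fin 2 → ℝ := ![1 - α, α] with hw
  have hw0 : ∀ a, 0 ≤ w a := by
    intro a; fin_cases a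
    · simp [hw, hα.2]
    · simp [hw, hα.1]
  have hws : w 0 + w 1 = 1 := by simp [hw]
  have xn : ∀ t s, 0 ≤ xseq d P w m t s := by
    intro t
    induction t with
    | zero => exact hmnn
    | succ t ih =>
      intro s
      exact Finset.sum_nonneg fun s' _ => Finset.sum_nonneg fun a _ =>
        mul_nonneg (mul_nonneg (hw0 a) (ih s')) (hPnn a s' s)
  have xs : ∀ t, ∑ s, xseq d P w m t s = 1 := by
    intro t
    induction t with
    | zero => exact hmsum
    | succ t ih =>
      rw [← ih]
      calc ∑ s, ∑ s', ∑ a, (w a * xseq d P w m t s') * P a s' s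
        = ∑ s', ∑ a, ∑ s, (w a * xseq d P w m t s') * P a s' s := by
            rw [Finset.sum_comm]
            exact Finset.sum_congr rfl fun s _ => Finset.sum_comm
        _ = _ := by
            simp only [← Finset.mul_sum, hProw, mul_one, Fin.sum_univ_two, ← add_mul, hws, one_mul]
  refine ⟨fun t s a => w a * xseq d P w m t s, fun t s a => mul_nonneg (hw0 a) (xn t s), ?_, ?_, ?_⟩
  · intro t ht s
    rw [← add_mul, hws, one_mul]; rfl
  · intro t
    rw [← Finset.mul_sum, xs]; simp [hw]
  · intro s
    rw [← add_mul, hws, one_mul]; rfl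

lemma ratio_step {ι : Type*} [Fintype ι] (y v : ι → ℝ) (hy : ∀ i, 0 ≤ y i)
    (hs : ∀ i, y i = 0 → v i = 0) (hneg : ∃ i, v i < 0) :
    ∃ e > 0, (∀ i, 0 ≤ y i + e * v i) ∧ ∃ j, 0 < y j ∧ y j + e * v j = 0 := by
  classical
  obtain ⟨i0, hi0⟩ := hneg
  obtain ⟨j, hj, hmin⟩ := Finset.exists_min_image (Finset.univ.filter fun i => v i < 0)
    (fun i => y i / (- v i)) ⟨i0, by simpa using hi0⟩
  simp only [Finset.mem_filter, Finset.mem_univ, true_and] at hj hmin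
  have hyj : 0 < y j := lt_of_le_of_ne (hy j) fun h => by
    have := hs j h.symm; linarith
  refine ⟨y j / (- v j), div_pos hyj (by linarith), ?_, j, hyj, ?_⟩
  · intro i
    by_cases hi : v i < 0
    · have h := hmin i hi
      rw [le_div_iff₀ (by linarith)] at h
      linarith
    · have := mul_nonneg (div_nonneg hyj.le (by linarith : 0 ≤ - v j)) (not_lt.mp hi)
      have := hy i
      linarith
  · have : v j ≠ 0 := hj.ne
    field_simp
    ring

open Classical in
lemma exists_dir (d T : ℕ) (hT : 1 ≤ T) (P : Fin 2 → Matrix (Fin d) (Fin d) ℝ)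
    (hPnn : ∀ a s s', 0 ≤ P a s s') (α : ℝ)
    (m : Fin d → ℝ) (y : Fin T → Fin d → Fin 2 → ℝ) (hy : y ∈ FeasY d T hT P α m)
    (hc : T < ∑ t : Fin T, ({s | 0 < y t s 0 ∧ 0 < y t s 1} : Set (Fin d)).ncard) :
    ∃ v, HomY d T hT P v ∧ (∀ t s a, y t s a = 0 → v t s a = 0) ∧ ∃ t s a, v t s a ≠ 0 := by
  obtain ⟨h0, h1, h2, h3⟩ := hy
  let I := {p : Fin T × Fin d × Fin 2 // 0 < y p.1 p.2.1 p.2.2}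
  let J := {p : Fin T × Fin d // 0 < y p.1 p.2 0 ∨ 0 < y p.1 p.2 1}
  let E : (I → ℝ) →ₗ[ℝ] (Fin T → Fin d → Fin 2 → ℝ) :=
    { toFun := fun v t s a => if h : 0 < y t s a then v ⟨(t, s, a), h⟩ else 0
      map_add' := by
        intro u v; funext t s a; simp only [Pi.add_apply]; split_ifs <;> simp
      map_smul' := by
        intro c v; funext t s a
        simp only [Pi.smul_apply, smul_eq_mul, RingHom.id_apply]; split_ifs <;> simp }
  let G : (Fin T → Fin d → Fin 2 → ℝ) →ₗ[ℝ] (J ⊕ Fin T → ℝ) :=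
    { toFun := fun v => Sum.elim
        (fun p => v p.1.1 p.1.2 0 + v p.1.1 p.1.2 1 -
          if p.1.1.1 = 0 then 0 else
            ∑ s', ∑ a, v ⟨p.1.1.1 - 1, by have := p.1.1.2; omega⟩ s' a * P a s' p.1.2)
        (fun t => ∑ s, v t s 1)
      map_add' := by
        intro u v; funext p
        rcases p with p | t
        · simp only [Sum.elim_inl, Pi.add_apply, add_mul, Finset.sum_add_distrib]
          split_ifs <;> ring
        · simp [Finset.sum_add_distrib]
      map_smul' := by
        intro c v; funext p
        rcases p with p | t
        · simp only [Sum.elim_inl, Pi.smul_apply, smul_eq_mul, RingHom.id_apply, mul_assoc,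
            ← Finset.mul_sum]
          split_ifs <;> ring
        · simp [Finset.mul_sum] }
  have hcard : Fintype.card J + T < Fintype.card I := by
    have e1 : Fintype.card I = ∑ t, ∑ s,
        ((if 0 < y t s 0 then 1 else 0) + (if 0 < y t s 1 then 1 else 0)) := by
      rw [Fintype.card_subtype, Finset.card_filter]
      simp only [Fintype.sum_prod_type, Fin.sum_univ_two]
    have e2 : Fintype.card J = ∑ t, ∑ s, (if 0 < y t s 0 ∨ 0 < y t s 1 then 1 else 0) := by
      rw [Fintype.card_subtype, Finset.card_filter]
      simp only [Fintype.sum_prod_type]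
    have e3 : ∑ t : Fin T, ({s | 0 < y t s 0 ∧ 0 < y t s 1} : Set (Fin d)).ncard
        = ∑ t, ∑ s, (if 0 < y t s 0 ∧ 0 < y t s 1 then 1 else 0) := by
      refine Finset.sum_congr rfl fun t _ => ?_
      rw [Set.ncard_eq_toFinset_card', Set.toFinset_setOf, Finset.card_filter]
    have e4 : Fintype.card I = Fintype.card J +
        ∑ t : Fin T, ({s | 0 < y t s 0 ∧ 0 < y t s 1} : Set (Fin d)).ncard := by
      rw [e1, e2, e3]
      simp only [← Finset.sum_add_distrib]
      refine Finset.sum_congr rfl fun t _ => Finset.sum_congr rfl fun s _ => ?_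
      by_cases p : 0 < y t s 0 <;> by_cases q : 0 < y t s 1 <;> simp [p, q]
    omega
  have hker : LinearMap.ker (G ∘ₗ E) ≠ ⊥ := by
    apply LinearMap.ker_ne_bot_of_finrank_lt
    simpa [Module.finrank_fintype_fun_eq_card] using hcard
  obtain ⟨u, hu, hu0⟩ := Submodule.exists_mem_ne_zero_of_ne_bot hker
  have hu' : G (E u) = 0 := hu
  have hE : ∀ t s a, E u t s a = if h : 0 < y t s a then u ⟨(t, s, a), h⟩ else 0 :=
    fun _ _ _ => rfl
  have hsupp : ∀ t s a, y t s a = 0 → E u t s a = 0 := by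
    intro t s a h; rw [hE, dif_neg (by rw [h]; exact lt_irrefl _)]
  refine ⟨E u, ⟨?_, ?_, ?_⟩, hsupp, ?_⟩
  · intro t ht s
    by_cases hv : 0 < y ⟨t+1, ht⟩ s 0 ∨ 0 < y ⟨t+1, ht⟩ s 1
    · have := congrFun hu' (Sum.inl ⟨(⟨t+1, ht⟩, s), hv⟩)
      simp only [G, LinearMap.coe_mk, AddHom.coe_mk, Sum.elim_inl, Pi.zero_apply,
        Nat.add_eq_zero_iff, one_ne_zero, and_false, if_false, Nat.add_sub_cancel] at this
      linarith
    · push Not at hv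
      have z0 : y ⟨t+1, ht⟩ s 0 = 0 := le_antisymm hv.1 (h0 _ _ _)
      have z1 : y ⟨t+1, ht⟩ s 1 = 0 := le_antisymm hv.2 (h0 _ _ _)
      rw [hsupp _ _ _ z0, hsupp _ _ _ z1]
      have hz := h1 t ht s
      rw [z0, z1, add_zero, eq_comm, Finset.sum_eq_zero_iff_of_nonneg
        (fun s' _ => Finset.sum_nonneg fun a _ => mul_nonneg (h0 _ _ _) (hPnn _ _ _))] at hz
      rw [add_zero, eq_comm]
      refine Finset.sum_eq_zero fun s' hs' => Finset.sum_eq_zero fun a ha => ?_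
      have hz' := hz s' hs'
      rw [Finset.sum_eq_zero_iff_of_nonneg
        (fun a _ => mul_nonneg (h0 _ _ _) (hPnn _ _ _))] at hz'
      rcases mul_eq_zero.mp (hz' a ha) with h | h
      · rw [hsupp _ _ _ h, zero_mul]
      · rw [h, mul_zero]
  · intro t
    exact congrFun hu' (Sum.inr t)
  · intro s
    by_cases hv : 0 < y ⟨0, hT⟩ s 0 ∨ 0 < y ⟨0, hT⟩ s 1
    · have := congrFun hu' (Sum.inl ⟨(⟨0, hT⟩, s), hv⟩)
      simpa [G] using this
    · push Not at hv
      rw [hsupp _ _ _ (le_antisymm hv.1 (h0 _ _ _)), hsupp _ _ _ (le_antisymm hv.2 (h0 _ _ _)),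
        add_zero]
  · by_contra hcon
    push Not at hcon
    apply hu0
    funext ⟨⟨t, s, a⟩, h⟩
    have := hcon t s a
    rw [hE, dif_pos h] at this
    exact this

def objY (d T : ℕ) (R : Fin 2 → Fin d → ℝ) (z : Fin T → Fin d → Fin 2 → ℝ) : ℝ :=
  ∑ t, ∑ s, ∑ a, R a s * z t s a

lemma objY_add (d T : ℕ) (R : Fin 2 → Fin d → ℝ) (y v : Fin T → Fin d → Fin 2 → ℝ) (l : ℝ) :
    objY d T R (fun t s a => y t s a + l * v t s a) = objY d T R y + l * objY d T R v := by
  simp only [objY, Finset.mul_sum, ← Finset.sum_add_distrib]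
  refine Finset.sum_congr rfl fun _ _ => Finset.sum_congr rfl fun _ _ =>
    Finset.sum_congr rfl fun _ _ => by ring

lemma HomY.neg {d T : ℕ} {hT : 1 ≤ T} {P : Fin 2 → Matrix (Fin d) (Fin d) ℝ}
    {v : Fin T → Fin d → Fin 2 → ℝ} (hv : HomY d T hT P v) :
    HomY d T hT P (fun t s a => - v t s a) := by
  obtain ⟨g1, g2, g3⟩ := hv
  refine ⟨?_, ?_, ?_⟩
  · intro t ht s
    simp only [neg_mul, Finset.sum_neg_distrib, ← g1 t ht s]; ring
  · intro t; simp [g2 t]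
  · intro s; linear_combination - g3 s

noncomputable def suppY {d T : ℕ} (y : Fin T → Fin d → Fin 2 → ℝ) : ℕ :=
  (({p | 0 < y p.1 p.2.1 p.2.2} : Set (Fin T × Fin d × Fin 2))).ncard

lemma improve (d T : ℕ) (hT : 1 ≤ T) (P : Fin 2 → Matrix (Fin d) (Fin d) ℝ)
    (hProw : ∀ a s, ∑ s', P a s s' = 1)
    (R : Fin 2 → Fin d → ℝ) (α : ℝ)
    (m : Fin d → ℝ) (hmsum : ∑ s, m s = 1)
    (y : Fin T → Fin d → Fin 2 → ℝ) (hy : y ∈ FeasY d T hT P α m)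
    (v : Fin T → Fin d → Fin 2 → ℝ) (hv : HomY d T hT P v)
    (hs : ∀ t s a, y t s a = 0 → v t s a = 0) (hne : ∃ t s a, v t s a ≠ 0)
    (hobj : 0 ≤ objY d T R v) :
    ∃ z ∈ FeasY d T hT P α m, objY d T R y ≤ objY d T R z ∧ suppY z < suppY y := by
  have hneg : ∃ p : Fin T × Fin d × Fin 2, v p.1 p.2.1 p.2.2 < 0 := by
    by_contra hcon
    push Not at hcon
    obtain ⟨t, s, a, hne⟩ := hne
    have hpos : 0 < v t s a := lt_of_le_of_ne (hcon (t, s, a)) hne.symm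
    have hf := feas_add d T hT P α m y v hy hv (2 / v t s a) (fun t' s' a' =>
      add_nonneg (hy.1 _ _ _) (mul_nonneg (by positivity) (hcon (t', s', a'))))
    have := feas_le_one d T hT P hProw α m hmsum _ hf t s a
    have h0 := hy.1 t s a
    simp only [div_mul_cancel₀ _ hpos.ne'] at this
    linarith
  obtain ⟨e, he, hnn, ⟨jt, js, ja⟩, hj, hj0⟩ := ratio_step
    (fun p : Fin T × Fin d × Fin 2 => y p.1 p.2.1 p.2.2) (fun p => v p.1 p.2.1 p.2.2)
    (fun p => hy.1 _ _ _) (fun p => hs _ _ _) hneg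
  refine ⟨_, feas_add d T hT P α m y v hy hv e (fun t s a => hnn (t, s, a)), ?_, ?_⟩
  · rw [objY_add]
    have := mul_nonneg he.le hobj
    linarith
  · apply Set.ncard_lt_ncard _ (Set.toFinite _)
    refine ⟨?_, ?_⟩
    · rintro ⟨t, s, a⟩ h
      simp only [Set.mem_setOf_eq] at h ⊢
      refine lt_of_le_of_ne (hy.1 _ _ _) fun h' => ?_
      rw [hs _ _ _ h'.symm, ← h'] at h
      simp at h
    · intro hsub
      have := hsub (show (jt, js, ja) ∈ _ from hj)
      simp only [Set.mem_setOf_eq] at this hj0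
      linarith

/-- The finite-horizon relaxed LP admits an optimal solution that
randomizes (i.e. has both `y_{s,0}(t) > 0` and `y_{s,1}(t) > 0`) in at most `T`
time–state pairs in total. -/
theorem relaxed_LP_optimal_solution_few_randomizations
    (d T : ℕ) (hd : 1 ≤ d) (hT : 1 ≤ T)
    (P : Fin 2 → Matrix (Fin d) (Fin d) ℝ)
    (hPnn : ∀ a s s', 0 ≤ P a s s')
    (hProw : ∀ a s, ∑ s', P a s s' = 1)
    (R : Fin 2 → Fin d → ℝ)
    (α : ℝ) (hα : α ∈ Set.Icc (0 : ℝ) 1)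
    (m : Fin d → ℝ) (hmnn : ∀ s, 0 ≤ m s) (hmsum : ∑ s, m s = 1)
    (F : Set (Fin T → Fin d → Fin 2 → ℝ))
    (hF : F = {y | (∀ t s a, 0 ≤ y t s a) ∧
      (∀ (t : ℕ) (ht : t + 1 < T) (s : Fin d),
        y ⟨t + 1, ht⟩ s 0 + y ⟨t + 1, ht⟩ s 1 =
          ∑ s', ∑ a, y ⟨t, by omega⟩ s' a * P a s' s) ∧
      (∀ t, ∑ s, y t s 1 = α) ∧
      (∀ s, y ⟨0, by omega⟩ s 0 + y ⟨0, by omega⟩ s 1 = m s)}) :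
    ∃ y ∈ F,
      (∀ z ∈ F,
        (∑ t, ∑ s, ∑ a, R a s * z t s a) ≤ ∑ t, ∑ s, ∑ a, R a s * y t s a) ∧
      ∑ t : Fin T, ({s | 0 < y t s 0 ∧ 0 < y t s 1} : Set (Fin d)).ncard ≤ T := by
  classical
  replace hF : F = FeasY d T hT P α m := hF
  subst hF
  obtain ⟨y0, hy0, hmax⟩ := (feas_compact d T hT P hProw α m hmsum).exists_isMaxOn
    (feas_nonempty d T hT P hPnn hProw α hα m hmnn hmsum)
    (f := objY d T R) (by unfold objY; fun_prop)
  let O : Set (Fin T → Fin d → Fin 2 → ℝ) :=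
    {y | y ∈ FeasY d T hT P α m ∧ ∀ z ∈ FeasY d T hT P α m, objY d T R z ≤ objY d T R y}
  have hO : O.Nonempty := ⟨y0, hy0, fun z hz => hmax hz⟩
  have hyO := Function.argminOn_mem suppY O hO
  have hmin := fun z (hz : z ∈ O) => Function.argminOn_le suppY O hz
  set y := Function.argminOn suppY O hO with hydef
  refine ⟨y, hyO.1, hyO.2, ?_⟩
  by_contra hc
  push Not at hc
  obtain ⟨v, hv, hs, hne⟩ := exists_dir d T hT P hPnn α m y hyO.1 hc
  have : ∃ z ∈ FeasY d T hT P α m, objY d T R y ≤ objY d T R z ∧ suppY z < suppY y := by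
    rcases le_total 0 (objY d T R v) with h | h
    · exact improve d T hT P hProw R α m hmsum y hyO.1 v hv hs hne h
    · refine improve d T hT P hProw R α m hmsum y hyO.1 _ hv.neg
        (fun t s a h => by rw [hs t s a h, neg_zero]) ?_ ?_
      · obtain ⟨t, s, a, h⟩ := hne
        exact ⟨t, s, a, neg_ne_zero.mpr h⟩
      · simp only [objY, mul_neg, Finset.sum_neg_distrib] at h ⊢
        linarith
  obtain ⟨z, hz, hle, hlt⟩ := this
  have := hmin z ⟨hz, fun w hw => (hyO.2 w hw).trans hle⟩
  exact absurd hlt (not_lt.mpr this)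
end

section
/- Let d ≥ 1, let P⁰, P¹ be d×d row-stochastic matrices, R⁰, R¹ ∈ ℝ^d, α ∈ [0,1], m ∈ Δ^d, and T ≥ 1. Suppose the finite-horizon relaxed LP has a unique optimal solution y*, and for each t set S⁰(t) = {s : y*_{s,0}(t) > 0 and y*_{s,1}(t) > 0}. If there exists t₀ with |S⁰(t₀)| ≥ 2 (the problem is not rankable), then there exists t₁ with S⁰(t₁) = ∅ (the problem is degenerate). -/
/-- Inflow into state `s` at time `t` (zero at time zero). -/
noncomputable def rbInflow (d T : ℕ) (P : Fin 2 → Matrix (Fin d) (Fin d) ℝ)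
    (z : Fin T → Fin d → Fin 2 → ℝ) (t : Fin T) (s : Fin d) : ℝ :=
  if 0 < t.1 then
    ∑ s', ∑ a, z ⟨t.1 - 1, lt_of_le_of_lt (Nat.sub_le _ _) t.2⟩ s' a * P a s' s else 0

/-- The linear system of the active constraints. -/
noncomputable def rbMap (d T : ℕ) (P : Fin 2 → Matrix (Fin d) (Fin d) ℝ)
    (y : Fin T → Fin d → Fin 2 → ℝ) :
    (Fin T → Fin d → Fin 2 → ℝ) →ₗ[ℝ]
      (({p : Fin T × Fin d × Fin 2 // ¬ 0 < y p.1 p.2.1 p.2.2} → ℝ) ×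
       ({p : Fin T × Fin d // 0 < y p.1 p.2 0 ∨ 0 < y p.1 p.2 1} → ℝ) × (Fin T → ℝ)) where
  toFun z := (fun p => z p.1.1 p.1.2.1 p.1.2.2,
    fun p => z p.1.1 p.1.2 0 + z p.1.1 p.1.2 1 - rbInflow d T P z p.1.1 p.1.2,
    fun t => ∑ s, z t s 1)
  map_add' z w := by
    refine Prod.ext ?_ (Prod.ext ?_ ?_)
    · rfl
    · funext p
      simp only [rbInflow, Pi.add_apply, Prod.snd_add, Prod.fst_add, add_mul,
        Finset.sum_add_distrib]
      split_ifs <;> ring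
    · funext t
      simp [Finset.sum_add_distrib]
  map_smul' c z := by
    refine Prod.ext ?_ (Prod.ext ?_ ?_)
    · rfl
    · funext p
      simp only [rbInflow, Pi.smul_apply, Prod.smul_snd, Prod.smul_fst, smul_eq_mul, mul_assoc,
        ← Finset.mul_sum, RingHom.id_apply]
      split_ifs <;> ring
    · funext t
      simp [Finset.mul_sum]

theorem rb_card (d T : ℕ) (y : Fin T → Fin d → Fin 2 → ℝ)
    (h1 : ∀ t, ∃ s, 0 < y t s 0 ∧ 0 < y t s 1)
    (h2 : ∃ t, ∃ s s', s ≠ s' ∧ (0 < y t s 0 ∧ 0 < y t s 1) ∧ (0 < y t s' 0 ∧ 0 < y t s' 1)) :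
    Nat.card {p : Fin T × Fin d × Fin 2 // ¬ 0 < y p.1 p.2.1 p.2.2} +
      (Nat.card {p : Fin T × Fin d // 0 < y p.1 p.2 0 ∨ 0 < y p.1 p.2 1} + T) < T * (d * 2) := by
  classical
  have e1 : Nat.card {p : Fin T × Fin d × Fin 2 // ¬ 0 < y p.1 p.2.1 p.2.2} =
      ∑ t, ∑ s, ∑ a, if ¬ 0 < y t s a then 1 else 0 := by
    rw [Nat.card_eq_fintype_card, Fintype.card_subtype, Finset.card_filter, Fintype.sum_prod_type]
    simp only [Fintype.sum_prod_type]
  have e2 : Nat.card {p : Fin T × Fin d // 0 < y p.1 p.2 0 ∨ 0 < y p.1 p.2 1} =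
      ∑ t, ∑ s, if 0 < y t s 0 ∨ 0 < y t s 1 then 1 else 0 := by
    rw [Nat.card_eq_fintype_card, Fintype.card_subtype, Finset.card_filter, Fintype.sum_prod_type]
  have e3 : ∀ t, ∑ s, (if 0 < y t s 0 ∧ 0 < y t s 1 then 1 else 0) =
      (Finset.univ.filter fun s => 0 < y t s 0 ∧ 0 < y t s 1).card := by
    intro t; rw [Finset.card_filter]
  have e4 : T < ∑ t, ∑ s, (if 0 < y t s 0 ∧ 0 < y t s 1 then 1 else 0) := by
    have : T = ∑ t : Fin T, 1 := by simp
    conv_lhs => rw [this]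
    apply Finset.sum_lt_sum
    · intro t _
      rw [e3]
      obtain ⟨s, hs⟩ := h1 t
      exact Finset.card_pos.2 ⟨s, by simpa using hs⟩
    · obtain ⟨t, s, s', hne, hs, hs'⟩ := h2
      refine ⟨t, Finset.mem_univ _, ?_⟩
      rw [e3]
      exact Finset.one_lt_card.2 ⟨s, by simpa using hs, s', by simpa using hs', hne⟩
  have e5 : (∑ t, ∑ s, ∑ a, if ¬ 0 < y t s a then 1 else 0) +
      (∑ t, ∑ s, if 0 < y t s 0 ∨ 0 < y t s 1 then 1 else 0) +
      (∑ t, ∑ s, (if 0 < y t s 0 ∧ 0 < y t s 1 then 1 else 0)) = T * (d * 2) := by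
    have : T * (d * 2) = ∑ t : Fin T, ∑ s : Fin d, 2 := by simp
    rw [this, ← Finset.sum_add_distrib, ← Finset.sum_add_distrib]
    refine Finset.sum_congr rfl fun t _ => ?_
    rw [← Finset.sum_add_distrib, ← Finset.sum_add_distrib]
    refine Finset.sum_congr rfl fun s _ => ?_
    rw [Fin.sum_univ_two]
    by_cases a : 0 < y t s 0 <;> by_cases b : 0 < y t s 1 <;> simp [a, b]
  omega

theorem rb_dir (d T : ℕ) (P : Fin 2 → Matrix (Fin d) (Fin d) ℝ)
    (y : Fin T → Fin d → Fin 2 → ℝ)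
    (h1 : ∀ t, ∃ s, 0 < y t s 0 ∧ 0 < y t s 1)
    (h2 : ∃ t, ∃ s s', s ≠ s' ∧ (0 < y t s 0 ∧ 0 < y t s 1) ∧ (0 < y t s' 0 ∧ 0 < y t s' 1)) :
    ∃ z : Fin T → Fin d → Fin 2 → ℝ, z ≠ 0 ∧ (∀ t s a, ¬ 0 < y t s a → z t s a = 0) ∧
      (∀ t s, (0 < y t s 0 ∨ 0 < y t s 1) → z t s 0 + z t s 1 = rbInflow d T P z t s) ∧
      (∀ t, ∑ s, z t s 1 = 0) := by
  classical
  have hc := rb_card d T y h1 h2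
  have hk : LinearMap.ker (rbMap d T P y) ≠ ⊥ := by
    apply LinearMap.ker_ne_bot_of_finrank_lt
    simp only [Module.finrank_prod, Module.finrank_fintype_fun_eq_card, Module.finrank_pi_fintype,
      Fintype.card_fin, Finset.sum_const, Finset.card_univ, smul_eq_mul]
    simpa only [Nat.card_eq_fintype_card] using hc
  obtain ⟨z, hz, hz0⟩ := (Submodule.ne_bot_iff _).1 hk
  rw [LinearMap.mem_ker] at hz
  have ha := congrArg Prod.fst hz
  have hb := congrArg (fun q => q.2.1) hz
  have hd := congrArg (fun q => q.2.2) hz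
  refine ⟨z, hz0, fun t s a h => congrFun ha ⟨(t, s, a), h⟩, fun t s h => ?_,
    fun t => congrFun hd t⟩
  have := congrFun hb ⟨(t, s), h⟩
  exact sub_eq_zero.1 this

/-- If the finite-horizon relaxed LP has a unique optimal solution
`y*` and `y*` randomizes in at least two states at some time (the problem is not
rankable), then at some other time it randomizes in no state at all (the problem is
degenerate). -/
theorem unique_solution_not_rankable_implies_degenerate
    (d T : ℕ) (hd : 1 ≤ d) (hT : 1 ≤ T)
    (P : Fin 2 → Matrix (Fin d) (Fin d) ℝ)
    (hPnn : ∀ a s s', 0 ≤ P a s s')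
    (hProw : ∀ a s, ∑ s', P a s s' = 1)
    (R : Fin 2 → Fin d → ℝ)
    (α : ℝ) (hα : α ∈ Set.Icc (0 : ℝ) 1)
    (m : Fin d → ℝ) (hmnn : ∀ s, 0 ≤ m s) (hmsum : ∑ s, m s = 1)
    (F : Set (Fin T → Fin d → Fin 2 → ℝ))
    (hF : F = {y | (∀ t s a, 0 ≤ y t s a) ∧
      (∀ (t : ℕ) (ht : t + 1 < T) (s : Fin d),
        y ⟨t + 1, ht⟩ s 0 + y ⟨t + 1, ht⟩ s 1 =
          ∑ s', ∑ a, y ⟨t, by omega⟩ s' a * P a s' s) ∧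
      (∀ t, ∑ s, y t s 1 = α) ∧
      (∀ s, y ⟨0, by omega⟩ s 0 + y ⟨0, by omega⟩ s 1 = m s)})
    (ystar : Fin T → Fin d → Fin 2 → ℝ)
    (hmem : ystar ∈ F)
    (hopt : ∀ z ∈ F,
      (∑ t, ∑ s, ∑ a, R a s * z t s a) ≤ ∑ t, ∑ s, ∑ a, R a s * ystar t s a)
    (huniq : ∀ z ∈ F,
      (∑ t, ∑ s, ∑ a, R a s * z t s a) = (∑ t, ∑ s, ∑ a, R a s * ystar t s a) →
      z = ystar) :
    (∃ t0 : Fin T,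
        2 ≤ ({s | 0 < ystar t0 s 0 ∧ 0 < ystar t0 s 1} : Set (Fin d)).ncard) →
    ∃ t1 : Fin T, ({s | 0 < ystar t1 s 0 ∧ 0 < ystar t1 s 1} : Set (Fin d)) = ∅ := by
  classical
  rintro ⟨t0, ht0⟩
  by_contra hcon
  have h1 : ∀ t, ∃ s, 0 < ystar t s 0 ∧ 0 < ystar t s 1 := by
    intro t
    by_contra h
    exact hcon ⟨t, Set.eq_empty_iff_forall_notMem.2 fun s hs => h ⟨s, hs⟩⟩
  have h2 : ∃ t, ∃ s s', s ≠ s' ∧ (0 < ystar t s 0 ∧ 0 < ystar t s 1) ∧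
      (0 < ystar t s' 0 ∧ 0 < ystar t s' 1) := by
    obtain ⟨s, s', hs, hs', hne⟩ := (Set.one_lt_ncard_iff (Set.toFinite _)).1 ht0
    exact ⟨t0, s, s', hne, hs, hs'⟩
  obtain ⟨z, hz0, hzs, hzf, hzb⟩ := rb_dir d T P ystar h1 h2
  subst hF
  obtain ⟨ynn, yflow, ybud, yini⟩ := hmem
  have zflow : ∀ (t : ℕ) (ht : t + 1 < T) (s : Fin d),
      z ⟨t + 1, ht⟩ s 0 + z ⟨t + 1, ht⟩ s 1 = ∑ s', ∑ a, z ⟨t, by omega⟩ s' a * P a s' s := by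
    intro t ht s
    by_cases hp : 0 < ystar ⟨t + 1, ht⟩ s 0 ∨ 0 < ystar ⟨t + 1, ht⟩ s 1
    · rw [hzf _ _ hp]
      simp [rbInflow]
    · rw [not_or] at hp
      rw [hzs _ _ _ hp.1, hzs _ _ _ hp.2, add_zero]
      have hy := yflow t ht s
      have a0 := ynn ⟨t + 1, ht⟩ s 0
      have a1 := ynn ⟨t + 1, ht⟩ s 1
      have hsum : ∑ s', ∑ a, ystar ⟨t, by omega⟩ s' a * P a s' s = 0 := by
        rw [← hy]; linarith [hp.1, hp.2, not_lt.1 hp.1, not_lt.1 hp.2]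
      symm
      refine Finset.sum_eq_zero fun s' _ => Finset.sum_eq_zero fun a _ => ?_
      have q1 := (Finset.sum_eq_zero_iff_of_nonneg (fun s' _ => Finset.sum_nonneg fun a _ =>
        mul_nonneg (ynn _ s' a) (hPnn a s' s))).1 hsum s' (Finset.mem_univ _)
      have q2 := (Finset.sum_eq_zero_iff_of_nonneg (fun a _ =>
        mul_nonneg (ynn _ s' a) (hPnn a s' s))).1 q1 a (Finset.mem_univ _)
      rcases mul_eq_zero.1 q2 with q | q
      · rw [hzs _ _ _ (by rw [q]; exact lt_irrefl _), zero_mul]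
      · rw [q, mul_zero]
  have zini : ∀ s, z ⟨0, by omega⟩ s 0 + z ⟨0, by omega⟩ s 1 = 0 := by
    intro s
    by_cases hp : 0 < ystar ⟨0, by omega⟩ s 0 ∨ 0 < ystar ⟨0, by omega⟩ s 1
    · rw [hzf _ _ hp]
      simp [rbInflow]
    · rw [not_or] at hp
      rw [hzs _ _ _ hp.1, hzs _ _ _ hp.2, add_zero]
  have hev : ∀ᶠ e in nhds (0 : ℝ), ∀ t s a, 0 ≤ ystar t s a + e * z t s a := by
    simp only [Filter.eventually_all]
    intro t s a
    by_cases hp : 0 < ystar t s a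
    · have hcont : Continuous fun e : ℝ => ystar t s a + e * z t s a := by fun_prop
      have := hcont.tendsto 0
      simp only [zero_mul, add_zero] at this
      exact (this.eventually (lt_mem_nhds hp)).mono fun e he => le_of_lt he
    · rw [hzs _ _ _ hp]
      simpa using ynn t s a
  obtain ⟨r, hr, hball⟩ := Metric.eventually_nhds_iff.1 hev
  have hfeas : ∀ e : ℝ, |e| < r → (fun t s a => ystar t s a + e * z t s a) ∈
      {y : Fin T → Fin d → Fin 2 → ℝ | (∀ t s a, 0 ≤ y t s a) ∧
      (∀ (t : ℕ) (ht : t + 1 < T) (s : Fin d),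
        y ⟨t + 1, ht⟩ s 0 + y ⟨t + 1, ht⟩ s 1 =
          ∑ s', ∑ a, y ⟨t, by omega⟩ s' a * P a s' s) ∧
      (∀ t, ∑ s, y t s 1 = α) ∧
      (∀ s, y ⟨0, by omega⟩ s 0 + y ⟨0, by omega⟩ s 1 = m s)} := by
    intro e he
    refine ⟨hball (by simpa using he), fun t ht s => ?_, fun t => ?_, fun s => ?_⟩
    · simp only [add_mul, Finset.sum_add_distrib, mul_assoc, ← Finset.mul_sum]
      rw [← zflow t ht s, ← yflow t ht s]
      ring
    · simp only [Finset.sum_add_distrib, ← Finset.mul_sum, hzb, ybud, mul_zero, add_zero]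
    · have i1 := yini s
      have i2 := zini s
      linear_combination i1 + e * i2
  have hobj : ∀ e : ℝ, (∑ t, ∑ s, ∑ a, R a s * (ystar t s a + e * z t s a)) =
      (∑ t, ∑ s, ∑ a, R a s * ystar t s a) + e * ∑ t, ∑ s, ∑ a, R a s * z t s a := by
    intro e
    simp only [Finset.mul_sum, ← Finset.sum_add_distrib]
    refine Finset.sum_congr rfl fun t _ => Finset.sum_congr rfl fun s _ =>
      Finset.sum_congr rfl fun a _ => by ring
  have hr2 : |r / 2| < r := by rw [abs_of_pos (by linarith)]; linarith
  have o1 := hopt _ (hfeas (r / 2) hr2)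
  have o2 := hopt _ (hfeas (-(r / 2)) (by rwa [abs_neg]))
  simp only [hobj] at o1 o2
  have hpr : r / 2 * ∑ t, ∑ s, ∑ a, R a s * z t s a = 0 := by linarith
  have hu := huniq _ (hfeas (r / 2) hr2) (by simp only [hobj]; rw [hpr, add_zero])
  apply hz0
  funext t s a
  have := congrFun (congrFun (congrFun hu t) s) a
  have h3 : r / 2 * z t s a = 0 := by simpa using this
  rcases mul_eq_zero.1 h3 with h | h
  · linarith
  · exact h
end

section
/- Let d ≥ 1, let P⁰, P¹ be d×d row-stochastic matrices, R⁰, R¹ ∈ ℝ^d and α ∈ [0,1]. Assume the unichain condition: for every ψ : {1,…,d} → [0,1], the row-stochastic matrix Q^ψ with entries Q^ψ_{s,s'} = ψ(s) P¹_{s,s'} + (1−ψ(s)) P⁰_{s,s'} has a unique invariant probability distribution. Then the infinite-horizon relaxed LP is feasible, its maximum is attained, and it admits an optimal solution y* such that |{s : y*_{s,0} > 0 and y*_{s,1} > 0}| ≤ 1; that is, y* randomizes in at most one state. -/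
/-- Key linear algebra: a nonzero direction exists when two states randomize. -/
lemma exists_direction {d : ℕ}
    (P : Fin 2 → Matrix (Fin d) (Fin d) ℝ)
    (hPnn : ∀ a s s', 0 ≤ P a s s')
    (hProw : ∀ a s, ∑ s', P a s s' = 1)
    (y : Fin d → Fin 2 → ℝ) (hy : ∀ s a, 0 ≤ y s a)
    (hbal : ∀ s, y s 0 + y s 1 = ∑ s', ∑ a, y s' a * P a s' s)
    (s1 s2 : Fin d) (hne : s1 ≠ s2)
    (h10 : 0 < y s1 0) (h11 : 0 < y s1 1) (h20 : 0 < y s2 0) (h21 : 0 < y s2 1) :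
    ∃ v : Fin d → Fin 2 → ℝ, v ≠ 0 ∧ (∀ s a, y s a = 0 → v s a = 0) ∧
      (∑ s, v s 1 = 0) ∧
      (∀ s, v s 0 + v s 1 = ∑ s', ∑ a, v s' a * P a s' s) ∧
      (∑ s, ∑ a, v s a = 0) := by
  classical
  let f : (Fin d → Fin 2 → ℝ) → (Fin d → Fin 2 → ℝ) := fun v s =>
    ![if s = s1 then ∑ s, ∑ a, v s a
      else if y s 0 = 0 ∧ y s 1 = 0 then v s 0
      else v s 0 + v s 1 - ∑ s', ∑ a, v s' a * P a s' s,
      if s = s1 then ∑ s, v s 1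
      else if s = s2 then 0
      else if y s 1 = 0 then v s 1
      else if y s 0 = 0 then v s 0 else 0]
  let L : (Fin d → Fin 2 → ℝ) →ₗ[ℝ] (Fin d → Fin 2 → ℝ) :=
    { toFun := f
      map_add' := by
        intro u v
        funext s a
        fin_cases a
        · simp only [f, Fin.sum_univ_two, Pi.add_apply, add_mul, Finset.sum_add_distrib]
          simp
          split_ifs <;> ring
        · simp only [f, Fin.sum_univ_two, Pi.add_apply, add_mul, Finset.sum_add_distrib]
          simp
          split_ifs <;> ring
      map_smul' := by
        intro c v
        funext s a
        fin_cases a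
        · simp only [f, Fin.sum_univ_two, Pi.smul_apply, smul_eq_mul, mul_assoc, ← mul_add,
            ← Finset.mul_sum]
          simp
          split_ifs <;> ring
        · simp only [f, Fin.sum_univ_two, Pi.smul_apply, smul_eq_mul, mul_assoc, ← mul_add,
            ← Finset.mul_sum]
          simp }
  have hns : ¬ Function.Surjective L := by
    intro h
    obtain ⟨v, hv⟩ := h (fun _ _ => 1)
    have := congrFun (congrFun hv s2) 1
    simp [L, f, hne.symm] at this
  have hni : ¬ Function.Injective L := fun h => hns (LinearMap.injective_iff_surjective.1 h)
  rw [injective_iff_map_eq_zero] at hni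
  push Not at hni
  obtain ⟨v, hv, hv0⟩ := hni
  have e0 : ∀ s, f v s 0 = 0 := fun s => congrFun (congrFun hv s) 0
  have e1 : ∀ s, f v s 1 = 0 := fun s => congrFun (congrFun hv s) 1
  have htot : ∑ s, ∑ a, v s a = 0 := by simpa [f] using e0 s1
  have hact : ∑ s, v s 1 = 0 := by simpa [f] using e1 s1
  have hs1 : ∀ s, y s 1 = 0 → v s 1 = 0 := by
    intro s h
    have n1 : s ≠ s1 := by rintro rfl; exact h11.ne' h
    have n2 : s ≠ s2 := by rintro rfl; exact h21.ne' h
    simpa [f, n1, n2, h] using e1 s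
  have hs0 : ∀ s, y s 0 = 0 → v s 0 = 0 := by
    intro s h
    have n1 : s ≠ s1 := by rintro rfl; exact h10.ne' h
    have n2 : s ≠ s2 := by rintro rfl; exact h20.ne' h
    by_cases h' : y s 1 = 0
    · simpa [f, n1, n2, h, h'] using e0 s
    · simpa [f, n1, n2, h, h'] using e1 s
  have hsupp : ∀ s a, y s a = 0 → v s a = 0 := by
    intro s a
    fin_cases a
    · exact hs0 s
    · exact hs1 s
  have hb : ∀ s, s ≠ s1 → v s 0 + v s 1 - ∑ s', ∑ a, v s' a * P a s' s = 0 := by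
    intro s n1
    by_cases h : y s 0 = 0 ∧ y s 1 = 0
    · have hz : ∑ s', ∑ a, y s' a * P a s' s = 0 := by rw [← hbal s, h.1, h.2, add_zero]
      have hnn : ∀ s' a, 0 ≤ y s' a * P a s' s := fun s' a => mul_nonneg (hy _ _) (hPnn _ _ _)
      have hz' : ∀ s' a, v s' a * P a s' s = 0 := by
        intro s' a
        have h1 := (Finset.sum_eq_zero_iff_of_nonneg
          (fun s' _ => Finset.sum_nonneg (fun a _ => hnn s' a))).1 hz s' (Finset.mem_univ _)
        have h2 := (Finset.sum_eq_zero_iff_of_nonneg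
          (fun a _ => hnn s' a)).1 h1 a (Finset.mem_univ _)
        rcases mul_eq_zero.1 h2 with h3 | h3
        · rw [hsupp _ _ h3, zero_mul]
        · rw [h3, mul_zero]
      simp only [hz', hs0 s h.1, hs1 s h.2]
      simp
    · have := e0 s
      simpa only [f, n1, h, if_false, Matrix.cons_val_zero] using this
  have hsum : ∑ s, (v s 0 + v s 1 - ∑ s', ∑ a, v s' a * P a s' s) = 0 := by
    rw [Finset.sum_sub_distrib, Finset.sum_comm]
    have : ∀ s', ∑ s, ∑ a, v s' a * P a s' s = v s' 0 + v s' 1 := by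
      intro s'
      rw [Finset.sum_comm]
      simp [← Finset.mul_sum, hProw]
    simp only [this, sub_self]
  refine ⟨v, hv0, hsupp, hact, ?_, htot⟩
  intro s
  by_cases h : s = s1
  · subst h
    rw [Finset.sum_eq_single s (fun b _ hbn => hb b hbn) (by simp)] at hsum
    linarith
  · linarith [hb s h]

/-- Under the unichain condition, the infinite-horizon relaxed LP
of a restless bandit is feasible, its maximum is attained, and it admits an optimal
solution that randomizes in at most one state. -/
theorem infinite_horizon_LP_optimal_solution_at_most_one_randomization
    (d : ℕ) (hd : 1 ≤ d)
    (P : Fin 2 → Matrix (Fin d) (Fin d) ℝ)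
    (hPnn : ∀ a s s', 0 ≤ P a s s')
    (hProw : ∀ a s, ∑ s', P a s s' = 1)
    (R : Fin 2 → Fin d → ℝ)
    (α : ℝ) (hα : α ∈ Set.Icc (0 : ℝ) 1)
    (hunichain : ∀ ψ : Fin d → ℝ, (∀ s, ψ s ∈ Set.Icc (0 : ℝ) 1) →
      ∃! μ : Fin d → ℝ, (∀ s, 0 ≤ μ s) ∧ (∑ s, μ s = 1) ∧
        (∀ s', ∑ s, μ s * (ψ s * P 1 s s' + (1 - ψ s) * P 0 s s') = μ s'))
    (F : Set (Fin d → Fin 2 → ℝ))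
    (hF : F = {y | (∀ s a, 0 ≤ y s a) ∧
      (∑ s, y s 1 = α) ∧
      (∀ s, y s 0 + y s 1 = ∑ s', ∑ a, y s' a * P a s' s) ∧
      (∑ s, ∑ a, y s a = 1)}) :
    F.Nonempty ∧
    ∃ y ∈ F,
      (∀ z ∈ F, (∑ s, ∑ a, R a s * z s a) ≤ ∑ s, ∑ a, R a s * y s a) ∧
      ({s | 0 < y s 0 ∧ 0 < y s 1} : Set (Fin d)).ncard ≤ 1 := by
  classical
  have hlin : ∀ (y v : Fin d → Fin 2 → ℝ) (c : ℝ), ∑ s, ∑ a, R a s * (y + c • v) s a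
      = ∑ s, ∑ a, R a s * y s a + c * ∑ s, ∑ a, R a s * v s a := by
    intro y v c
    simp only [Pi.add_apply, Pi.smul_apply, smul_eq_mul, mul_add, Finset.sum_add_distrib,
      Finset.mul_sum, mul_left_comm]
  have hne : F.Nonempty := by
    obtain ⟨m1, ⟨a1, b1, c1⟩, -⟩ := hunichain (fun _ => 1) (by simp)
    obtain ⟨m0, ⟨a0, b0, c0⟩, -⟩ := hunichain (fun _ => 0) (by simp)
    simp at c1 c0
    refine ⟨fun s => ![(1 - α) * m0 s, α * m1 s], ?_⟩
    rw [hF]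
    refine ⟨?_, ?_, ?_, ?_⟩
    · intro s a
      fin_cases a
      · exact mul_nonneg (by linarith [hα.2]) (a0 s)
      · exact mul_nonneg hα.1 (a1 s)
    · simp [← Finset.mul_sum, b1]
    · intro s
      simp [Finset.sum_add_distrib, mul_assoc, ← Finset.mul_sum, c1, c0]
    · simp [Finset.sum_add_distrib, ← Finset.mul_sum, b1, b0]
  have hclosed : IsClosed F := by
    rw [hF]
    simp only [Set.ofPred_and, Set.ofPred_forall]
    refine IsClosed.inter ?_ (IsClosed.inter ?_ (IsClosed.inter ?_ ?_))
    · exact isClosed_iInter fun s => isClosed_iInter fun a =>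
        isClosed_le (by fun_prop) (by fun_prop)
    · exact isClosed_eq (by fun_prop) (by fun_prop)
    · exact isClosed_iInter fun s => isClosed_eq (by fun_prop) (by fun_prop)
    · exact isClosed_eq (by fun_prop) (by fun_prop)
  have hcomp : IsCompact F := by
    refine IsCompact.of_isClosed_subset
      (isCompact_Icc (a := (0 : Fin d → Fin 2 → ℝ)) (b := fun _ _ => 1)) hclosed ?_
    intro y hy
    rw [hF] at hy
    obtain ⟨h1, -, -, h4⟩ := hy
    refine ⟨fun s a => h1 s a, fun s a => ?_⟩
    calc y s a ≤ ∑ a, y s a :=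
          Finset.single_le_sum (f := fun a => y s a) (fun a _ => h1 s a) (Finset.mem_univ a)
      _ ≤ ∑ s, ∑ a, y s a :=
          Finset.single_le_sum (f := fun s => ∑ a, y s a)
            (fun s _ => Finset.sum_nonneg fun a _ => h1 s a) (Finset.mem_univ s)
      _ = 1 := h4
  have hcont : Continuous (fun y : Fin d → Fin 2 → ℝ => ∑ s, ∑ a, R a s * y s a) := by fun_prop
  obtain ⟨y0, hy0, hmax⟩ := hcomp.exists_isMaxOn hne hcont.continuousOn
  let O : Set (Fin d → Fin 2 → ℝ) :=
    F ∩ {y | ∑ s, ∑ a, R a s * y s a = ∑ s, ∑ a, R a s * y0 s a}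
  have hOc : IsCompact O := hcomp.inter_right (isClosed_eq hcont continuous_const)
  obtain ⟨y, hyE⟩ := hOc.extremePoints_nonempty ⟨y0, hy0, rfl⟩
  have hyO : y ∈ O := hyE.1
  have hopt : ∀ z ∈ F, (∑ s, ∑ a, R a s * z s a) ≤ ∑ s, ∑ a, R a s * y s a := by
    intro z hz
    rw [hyO.2]
    exact hmax hz
  refine ⟨hne, y, hyO.1, hopt, ?_⟩
  rw [Set.ncard_le_one (Set.toFinite _)]
  intro s1 hs1 s2 hs2
  by_contra hss
  have hyF := hyO.1
  rw [hF] at hyF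
  obtain ⟨f1, f2, f3, f4⟩ := hyF
  obtain ⟨v, v0, w1, w2, w3, w4⟩ := exists_direction P hPnn hProw y f1 f3 s1 s2 hss
    hs1.1 hs1.2 hs2.1 hs2.2
  have hev : ∀ᶠ e in nhdsWithin (0 : ℝ) (Set.Ioi 0), ∀ s a, e * |v s a| ≤ y s a := by
    rw [Filter.eventually_all]
    intro s
    rw [Filter.eventually_all]
    intro a
    rcases (f1 s a).eq_or_lt with h | h
    · simp [w1 s a h.symm, ← h]
    · have : Filter.Tendsto (fun e : ℝ => e * |v s a|) (nhdsWithin 0 (Set.Ioi 0)) (nhds 0) := by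
        have : Continuous (fun e : ℝ => e * |v s a|) := by fun_prop
        simpa using (this.tendsto 0).mono_left nhdsWithin_le_nhds
      exact (this.eventually (gt_mem_nhds h)).mono fun _ h => le_of_lt h
  obtain ⟨e, he, hepos⟩ := (hev.and self_mem_nhdsWithin).exists
  have hepos : 0 < e := hepos
  have hmem : ∀ c : ℝ, |c| = e → y + c • v ∈ F := by
    intro c hc
    rw [hF]
    refine ⟨?_, ?_, ?_, ?_⟩
    · intro s a
      have h1 := he s a
      rw [← hc, ← abs_mul] at h1
      have h2 := neg_abs_le (c * v s a)
      simp only [Pi.add_apply, Pi.smul_apply, smul_eq_mul]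
      linarith
    · simp [Finset.sum_add_distrib, ← Finset.mul_sum, w2, f2]
    · intro s
      simp only [Pi.add_apply, Pi.smul_apply, smul_eq_mul, add_mul, mul_assoc,
        Finset.sum_add_distrib, ← Finset.mul_sum]
      rw [← f3 s, ← w3 s]
      ring
    · simp only [Pi.add_apply, Pi.smul_apply, smul_eq_mul,
        Finset.sum_add_distrib, ← Finset.mul_sum]
      rw [f4, w4]
      ring
  have m1 := hmem e (abs_of_pos hepos)
  have m2 := hmem (-e) (by rw [abs_neg, abs_of_pos hepos])
  have o1 := hopt _ m1
  have o2 := hopt _ m2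
  rw [hlin] at o1 o2
  have hz : e * ∑ s, ∑ a, R a s * v s a = 0 := by linarith
  have n1 : y + e • v ∈ O := ⟨m1, by
    change _ = _
    rw [hlin, hz, add_zero]; exact hyO.2⟩
  have n2 : y + (-e) • v ∈ O := ⟨m2, by
    change _ = _
    rw [hlin, neg_mul, hz, neg_zero, add_zero]; exact hyO.2⟩
  have hseg : y ∈ openSegment ℝ (y + e • v) (y + (-e) • v) := by
    refine ⟨1/2, 1/2, by norm_num, by norm_num, by norm_num, ?_⟩
    module
  have := hyE.2 n1 n2 hseg
  have h5 : e • v = 0 := by simpa using this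
  rcases smul_eq_zero.1 h5 with h | h
  · exact hepos.ne' h
  · exact v0 h
end

section
/- Let p₁, p₂, q₁, q₂ ∈ [0,1] satisfy q₁ + p₂ > 1 + p₁ + q₂. Define f : [0, 1/2] → ℝ by f(β) = β + min( 1/2, β(p₁+q₂) + (1/2 − β)(q₁+p₂) ). Then f attains its maximum over [0, 1/2] at the unique point β* = (1/2) · (q₁+p₂−1) / ((q₁+p₂) − (p₁+q₂)), and 0 < β* < 1/2. In particular the maximizer is neither 0 nor 1/2. -/
/-- In the degenerate two-state restless bandit example, the LP
value `f(β) = β + min(1/2, β(p₁+q₂) + (1/2−β)(q₁+p₂))` attains its maximum over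
`[0, 1/2]` at the unique point `β* = (1/2)(q₁+p₂−1)/((q₁+p₂)−(p₁+q₂))`, which lies
strictly between `0` and `1/2`. -/
theorem degenerate_two_state_example_interior_maximizer
    (p₁ p₂ q₁ q₂ : ℝ)
    (hp₁ : p₁ ∈ Set.Icc (0 : ℝ) 1) (hp₂ : p₂ ∈ Set.Icc (0 : ℝ) 1)
    (hq₁ : q₁ ∈ Set.Icc (0 : ℝ) 1) (hq₂ : q₂ ∈ Set.Icc (0 : ℝ) 1)
    (hdeg : 1 + p₁ + q₂ < q₁ + p₂)
    (f : ℝ → ℝ)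
    (hf : ∀ β, f β = β + min (1 / 2) (β * (p₁ + q₂) + (1 / 2 - β) * (q₁ + p₂)))
    (βstar : ℝ)
    (hβstar : βstar = (1 / 2) * (q₁ + p₂ - 1) / ((q₁ + p₂) - (p₁ + q₂))) :
    (∀ β ∈ Set.Icc (0 : ℝ) (1 / 2), f β ≤ f βstar) ∧
    (∀ β ∈ Set.Icc (0 : ℝ) (1 / 2), f β = f βstar → β = βstar) ∧
    0 < βstar ∧ βstar < 1 / 2 := by
  obtain ⟨hp₁0, hp₁1⟩ := hp₁
  obtain ⟨hp₂0, hp₂1⟩ := hp₂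
  obtain ⟨hq₁0, hq₁1⟩ := hq₁
  obtain ⟨hq₂0, hq₂1⟩ := hq₂
  have hD : 0 < (q₁ + p₂) - (p₁ + q₂) := by linarith
  have hmul : βstar * ((q₁ + p₂) - (p₁ + q₂)) = (1 / 2) * (q₁ + p₂ - 1) := by
    rw [hβstar]
    exact div_mul_cancel₀ _ hD.ne'
  have hval : βstar * (p₁ + q₂) + (1 / 2 - βstar) * (q₁ + p₂) = 1 / 2 := by linarith
  have hfs : f βstar = βstar + 1 / 2 := by
    rw [hf, hval, min_self]
  have key : ∀ β, β ≠ βstar → f β < f βstar := by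
    intro β hne
    rw [hfs, hf]
    rcases lt_or_gt_of_ne hne with h | h
    · have := min_le_left (1 / 2 : ℝ) (β * (p₁ + q₂) + (1 / 2 - β) * (q₁ + p₂))
      linarith
    · have := min_le_right (1 / 2 : ℝ) (β * (p₁ + q₂) + (1 / 2 - β) * (q₁ + p₂))
      have h2 : 0 < (β - βstar) * ((q₁ + p₂) - (p₁ + q₂) - 1) :=
        mul_pos (by linarith) (by linarith)
      linarith
  refine ⟨fun β _ => ?_, fun β _ h => ?_, ?_, ?_⟩
  · by_cases h : β = βstar
    · rw [h]
    · exact (key β h).le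
  · by_contra hne
    exact (key β hne).ne h
  · rw [hβstar]
    exact div_pos (by linarith) hD
  · rw [hβstar, div_lt_iff₀ hD]
    linarith
end
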